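/- arXiv:1808.09406 — 8 statements merged into one kernel-verified Lean document; each statement's English description precedes it below -/
import Mathlib

section
/- For a path of m ≥ 1 items v_1,…,v_m and an agent i with a monotonic valuation u_i, a lumpy tie exists: there is a (unique smallest) index j ∈ {1,…,m} such that u_i(L(v_j) ∪ {v_j}) ≥ u_i(R(v_j)) and u_i(R(v_j) ∪ {v_j}) ≥ u_i(L(v_j)), where L(v_j) = {v_1,…,v_{j−1}} and R(v_j) = {v_{j+1},…,v_m}. -/
/-- A bundle of items on a path `v_1, …, v_m` (modeled as `Fin m`) is connected
iff it is an interval (possibly empty). -/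
def IsInterval {m : ℕ} (I : Finset (Fin m)) : Prop :=
  ∀ a b c : Fin m, a ≤ b → b ≤ c → a ∈ I → c ∈ I → b ∈ I

/-- A valuation is monotonic if larger bundles are weakly better. -/
def Monotonic {m : ℕ} (u : Finset (Fin m) → ℝ) : Prop :=
  ∀ X Y : Finset (Fin m), X ⊆ Y → u X ≤ u Y

/-- For a path of `m ≥ 1` items and an agent with a monotonic valuation `u`,
a lumpy tie exists: there is a smallest index `j` such that
`u (L(v_j) ∪ {v_j}) ≥ u (R(v_j))` and `u (R(v_j) ∪ {v_j}) ≥ u (L(v_j))`,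
where `L(v_j) = Iio j` and `R(v_j) = Ioi j`. -/
theorem lumpy_tie_exists {m : ℕ} (hm : 1 ≤ m) (u : Finset (Fin m) → ℝ)
    (hmono : Monotonic u) (h0 : u ∅ = 0) :
    ∃ j : Fin m,
      (u (Finset.Ioi j) ≤ u (insert j (Finset.Iio j)) ∧
        u (Finset.Iio j) ≤ u (insert j (Finset.Ioi j))) ∧
      ∀ k : Fin m,
        (u (Finset.Ioi k) ≤ u (insert k (Finset.Iio k)) ∧
          u (Finset.Iio k) ≤ u (insert k (Finset.Ioi k))) → j ≤ k := by
  have hlast : u (Finset.Ioi (⟨m - 1, by omega⟩ : Fin m)) ≤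
      u (insert ⟨m - 1, by omega⟩ (Finset.Iio ⟨m - 1, by omega⟩)) := by
    apply hmono
    intro x hx
    have := x.isLt
    simp only [Finset.mem_Ioi, Fin.lt_def] at hx
    omega
  obtain ⟨j, hj, hmin⟩ := (wellFounded_lt (α := Fin m)).has_min
    {j | u (Finset.Ioi j) ≤ u (insert j (Finset.Iio j))} ⟨_, hlast⟩
  refine ⟨j, ⟨hj, ?_⟩, fun k hk => not_lt.mp (hmin k hk.1)⟩
  by_cases hj0 : j.val = 0
  · apply hmono
    intro x hx
    simp only [Finset.mem_Iio, Fin.lt_def] at hx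
    omega
  · have hj' := j.isLt
    let p : Fin m := ⟨j.val - 1, by omega⟩
    have hlt : u (insert p (Finset.Iio p)) < u (Finset.Ioi p) := by
      by_contra h
      refine hmin p (not_lt.mp h) ?_
      simp only [p, Fin.lt_def]
      omega
    have hL : insert p (Finset.Iio p) = Finset.Iio j := by
      ext x
      simp only [p, Finset.mem_insert, Finset.mem_Iio, Fin.lt_def, Fin.ext_iff]
      omega
    have hR : Finset.Ioi p = insert j (Finset.Ioi j) := by
      ext x
      simp only [p, Finset.mem_insert, Finset.mem_Ioi, Fin.lt_def, Fin.ext_iff]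
      omega
    rw [hL, hR] at hlt
    exact hlt.le
end

section
/- Let G = (V, E) be a finite undirected graph that admits a bipolar numbering. Then for any two agents with monotonic valuations over the connected bundles of G, there exists a connected EF1 allocation; moreover, such an allocation can be taken so that one agent receives an initial segment and the other a terminal segment of the bipolar numbering. -/
variable {V : Type*}

/-- A bundle `I` is connected in `G` if the induced subgraph on `I` is preconnected
(this holds vacuously for the empty bundle). -/
def GConnBundle (G : SimpleGraph V) (I : Finset V) : Prop :=
  (G.induce (↑I : Set V)).Preconnected

/-- A valuation over bundles is monotonic if larger bundles are weakly better. -/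
def GMonotonic (u : Finset V → ℝ) : Prop :=
  ∀ X Y : Finset V, X ⊆ Y → u X ≤ u Y

/-- A connected allocation: every bundle is connected in `G`, bundles are pairwise disjoint,
and every item belongs to some bundle. -/
def GConnAlloc {n : ℕ} (G : SimpleGraph V) (A : Fin n → Finset V) : Prop :=
  (∀ i, GConnBundle G (A i)) ∧ (∀ i j, i ≠ j → Disjoint (A i) (A j)) ∧
    ∀ v : V, ∃ i, v ∈ A i

/-- EF1 (envy-freeness up to one outer good) for connected bundles of a graph. -/
def GEF1 {n : ℕ} [DecidableEq V] (G : SimpleGraph V) (u : Fin n → Finset V → ℝ)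
    (A : Fin n → Finset V) : Prop :=
  ∀ i j : Fin n, A j = ∅ ∨
    ∃ v ∈ A j, GConnBundle G (A j \ {v}) ∧ u i (A j \ {v}) ≤ u i (A i)

/-- A bipolar numbering of `G`: an ordering `e` of the vertices such that every initial
segment `{v_1,…,v_j}` and every terminal segment `{v_j,…,v_m}` is connected. -/
def BipolarNumbering [Fintype V] [DecidableEq V] (G : SimpleGraph V)
    (e : Fin (Fintype.card V) ≃ V) : Prop :=
  ∀ j : Fin (Fintype.card V),
    GConnBundle G ((Finset.Iic j).image e) ∧ GConnBundle G ((Finset.Ici j).image e)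

/-- The first `k` vertices of an ordering. -/
def initialSegment [DecidableEq V] {m : ℕ} (e : Fin m ≃ V) (k : ℕ) : Finset V :=
  (Finset.univ.filter fun x : Fin m => x.val < k).image e

/-- All but the first `k` vertices of an ordering. -/
def terminalSegment [DecidableEq V] {m : ℕ} (e : Fin m ≃ V) (k : ℕ) : Finset V :=
  (Finset.univ.filter fun x : Fin m => k ≤ x.val).image e

/-- An owner of `X` with valuation `u` does not envy `Y` after removing some outer good. -/
def EnvyFreeUpToOne [DecidableEq V] (G : SimpleGraph V) (u : Finset V → ℝ)
    (X Y : Finset V) : Prop :=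
  Y = ∅ ∨ ∃ v ∈ Y, GConnBundle G (Y \ {v}) ∧ u (Y \ {v}) ≤ u X

section Segments

variable [DecidableEq V] {m : ℕ} (e : Fin m ≃ V)

theorem mem_initialSegment {k : ℕ} {v : V} :
    v ∈ initialSegment e k ↔ (e.symm v).val < k := by
  simp only [initialSegment, Finset.mem_image, Finset.mem_filter, Finset.mem_univ, true_and]
  exact ⟨by rintro ⟨x, hx, rfl⟩; simpa using hx, fun h => ⟨_, h, by simp⟩⟩

theorem mem_terminalSegment {k : ℕ} {v : V} :
    v ∈ terminalSegment e k ↔ k ≤ (e.symm v).val := by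
  simp only [terminalSegment, Finset.mem_image, Finset.mem_filter, Finset.mem_univ, true_and]
  exact ⟨by rintro ⟨x, hx, rfl⟩; simpa using hx, fun h => ⟨_, h, by simp⟩⟩

theorem initialSegment_zero : initialSegment e 0 = ∅ := by
  simp [initialSegment]

theorem terminalSegment_card : terminalSegment e m = ∅ := by
  ext v
  simp [mem_terminalSegment]

theorem initialSegment_succ_sdiff {k : ℕ} (hk : k < m) :
    initialSegment e (k + 1) \ {e ⟨k, hk⟩} = initialSegment e k := by
  ext v
  simp only [Finset.mem_sdiff, mem_initialSegment, Finset.mem_singleton, ← e.symm_apply_eq,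
    Fin.ext_iff]
  omega

theorem terminalSegment_sdiff {k : ℕ} (hk : k < m) :
    terminalSegment e k \ {e ⟨k, hk⟩} = terminalSegment e (k + 1) := by
  ext v
  simp only [Finset.mem_sdiff, mem_terminalSegment, Finset.mem_singleton, ← e.symm_apply_eq,
    Fin.ext_iff]
  omega

theorem envyFreeUpToOne_initialSegment_succ_of_le {G : SimpleGraph V} {u : Finset V → ℝ}
    {X : Finset V} {k : ℕ} (hk : k < m) (hG : GConnBundle G (initialSegment e k))
    (h : u (initialSegment e k) ≤ u X) : EnvyFreeUpToOne G u X (initialSegment e (k + 1)) := by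
  refine Or.inr ⟨e ⟨k, hk⟩, by simp [mem_initialSegment], ?_⟩
  rw [initialSegment_succ_sdiff]
  exact ⟨hG, h⟩

theorem envyFreeUpToOne_terminalSegment_of_succ_le {G : SimpleGraph V} {u : Finset V → ℝ}
    {X : Finset V} {k : ℕ} (hk : k < m) (hG : GConnBundle G (terminalSegment e (k + 1)))
    (h : u (terminalSegment e (k + 1)) ≤ u X) :
    EnvyFreeUpToOne G u X (terminalSegment e k) := by
  refine Or.inr ⟨e ⟨k, hk⟩, by simp [mem_terminalSegment], ?_⟩
  rw [terminalSegment_sdiff]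
  exact ⟨hG, h⟩

end Segments

theorem gConnBundle_empty (G : SimpleGraph V) : GConnBundle G ∅ :=
  fun x => absurd x.2 (by simp)

namespace BipolarNumbering

variable [Fintype V] [DecidableEq V] {G : SimpleGraph V}
  {e : Fin (Fintype.card V) ≃ V} {u : Finset V → ℝ} {X : Finset V} {k : ℕ}

theorem gConnBundle_initialSegment (he : BipolarNumbering G e) (hk : k ≤ Fintype.card V) :
    GConnBundle G (initialSegment e k) := by
  cases k with
  | zero => rw [initialSegment_zero]; exact gConnBundle_empty G
  | succ k =>
    convert (he ⟨k, hk⟩).1 using 2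
    simp [initialSegment, Fin.le_def, Finset.ext_iff]

theorem gConnBundle_terminalSegment (he : BipolarNumbering G e) (hk : k ≤ Fintype.card V) :
    GConnBundle G (terminalSegment e k) := by
  rcases hk.eq_or_lt with rfl | hk
  · rw [terminalSegment_card]; exact gConnBundle_empty G
  · convert (he ⟨k, hk⟩).2 using 2
    simp [terminalSegment, Fin.le_def, Finset.ext_iff]

theorem envyFreeUpToOne_initialSegment (he : BipolarNumbering G e) (hu : GMonotonic u)
    (hk : k ≤ Fintype.card V) (h : u (initialSegment e k) ≤ u X) :
    EnvyFreeUpToOne G u X (initialSegment e k) := by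
  cases k with
  | zero => exact Or.inl (initialSegment_zero e)
  | succ k =>
    refine envyFreeUpToOne_initialSegment_succ_of_le e hk
      (he.gConnBundle_initialSegment (by omega)) ((hu _ _ fun v => ?_).trans h)
    simp only [mem_initialSegment]
    omega

theorem envyFreeUpToOne_terminalSegment (he : BipolarNumbering G e) (hu : GMonotonic u)
    (hk : k ≤ Fintype.card V) (h : u (terminalSegment e k) ≤ u X) :
    EnvyFreeUpToOne G u X (terminalSegment e k) := by
  rcases hk.eq_or_lt with rfl | hk
  · exact Or.inl (terminalSegment_card e)
  · refine envyFreeUpToOne_terminalSegment_of_succ_le e hk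
      (he.gConnBundle_terminalSegment hk) ((hu _ _ fun v => ?_).trans h)
    simp only [mem_terminalSegment]
    omega

/-- An agent can cut a bipolar numbering so that either side is acceptable to her. -/
theorem exists_cut (he : BipolarNumbering G e) (hu : GMonotonic u) :
    ∃ k ≤ Fintype.card V,
      EnvyFreeUpToOne G u (initialSegment e k) (terminalSegment e k) ∧
      EnvyFreeUpToOne G u (terminalSegment e k) (initialSegment e k) := by
  classical
  have hex : ∃ k, k ≤ Fintype.card V ∧ u (terminalSegment e k) ≤ u (initialSegment e k) :=
    ⟨_, le_rfl, hu _ _ (by simp [terminalSegment_card])⟩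
  obtain ⟨hk, hle⟩ := Nat.find_spec hex
  have hmin := fun l => Nat.find_min hex (m := l)
  generalize Nat.find hex = k at hk hle hmin
  cases k with
  | zero =>
    exact ⟨0, hk, he.envyFreeUpToOne_terminalSegment hu hk hle, Or.inl (initialSegment_zero e)⟩
  | succ k =>
    have hk' : k ≤ Fintype.card V := by omega
    have hlt : u (initialSegment e k) < u (terminalSegment e k) := by
      by_contra! h
      exact hmin k k.lt_succ_self ⟨hk', h⟩
    rcases le_total (u (initialSegment e k)) (u (terminalSegment e (k + 1))) with h | h
    · exact ⟨k + 1, hk, he.envyFreeUpToOne_terminalSegment hu hk hle,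
        envyFreeUpToOne_initialSegment_succ_of_le e hk (he.gConnBundle_initialSegment hk') h⟩
    · exact ⟨k, hk', envyFreeUpToOne_terminalSegment_of_succ_le e hk
        (he.gConnBundle_terminalSegment hk) h,
        he.envyFreeUpToOne_initialSegment hu hk' hlt.le⟩

end BipolarNumbering

/-- if `G` admits a bipolar numbering `e`, then for any two agents with
monotonic valuations over the connected bundles of `G` there exists a connected EF1
allocation; moreover it can be taken so that one agent receives an initial segment of the
numbering and the other the complementary terminal segment. -/
theorem bipolar_EF1_two_agents {V : Type*} [Fintype V] [DecidableEq V]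
    (G : SimpleGraph V) (e : Fin (Fintype.card V) ≃ V) (he : BipolarNumbering G e)
    (u : Fin 2 → Finset V → ℝ)
    (hmono : ∀ i, GMonotonic (u i)) (h0 : ∀ i, u i ∅ = 0) :
    ∃ A : Fin 2 → Finset V, GConnAlloc G A ∧ GEF1 G u A ∧
      ∃ S : Finset (Fin (Fintype.card V)),
        (∀ a b : Fin (Fintype.card V), a ≤ b → b ∈ S → a ∈ S) ∧
        ((A 0 = S.image e ∧ A 1 = Sᶜ.image e) ∨
         (A 1 = S.image e ∧ A 0 = Sᶜ.image e)) := by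
  obtain ⟨k, hk, hIT, hTI⟩ := he.exists_cut (hmono 0)
  have hI := he.gConnBundle_initialSegment hk
  have hT := he.gConnBundle_terminalSegment hk
  have hdisj : Disjoint (initialSegment e k) (terminalSegment e k) := by
    rw [Finset.disjoint_left]
    intro v
    simp only [mem_initialSegment, mem_terminalSegment]
    omega
  have hcover : ∀ v, v ∈ initialSegment e k ∨ v ∈ terminalSegment e k := fun v => by
    simp only [mem_initialSegment, mem_terminalSegment]
    omega
  have hcompl : (Finset.univ.filter fun x : Fin (Fintype.card V) => x.val < k)ᶜ.image e =
      terminalSegment e k := by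
    rw [terminalSegment]
    congr 1
    ext x
    simp
  have hdown : ∀ a b : Fin (Fintype.card V), a ≤ b →
      b ∈ Finset.univ.filter (fun x : Fin (Fintype.card V) => x.val < k) →
      a ∈ Finset.univ.filter (fun x : Fin (Fintype.card V) => x.val < k) := by
    intro a b hab
    simp only [Finset.mem_filter, Finset.mem_univ, true_and]
    exact (Fin.le_def.mp hab).trans_lt
  have hselfI := fun i => he.envyFreeUpToOne_initialSegment (hmono i) hk le_rfl
  have hselfT := fun i => he.envyFreeUpToOne_terminalSegment (hmono i) hk le_rfl
  rcases le_total (u 1 (initialSegment e k)) (u 1 (terminalSegment e k)) with h | h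
  · refine ⟨![initialSegment e k, terminalSegment e k], ⟨?_, ?_, ?_⟩, ?_, _, hdown,
      Or.inl ⟨rfl, hcompl.symm⟩⟩
    · exact Fin.forall_fin_two.mpr ⟨hI, hT⟩
    · simp [Fin.forall_fin_two, hdisj, hdisj.symm]
    · exact fun v => Fin.exists_fin_two.mpr (hcover v)
    · exact Fin.forall_fin_two.mpr ⟨Fin.forall_fin_two.mpr ⟨hselfI 0, hIT⟩,
        Fin.forall_fin_two.mpr
          ⟨he.envyFreeUpToOne_initialSegment (hmono 1) hk h, hselfT 1⟩⟩
  · refine ⟨![terminalSegment e k, initialSegment e k], ⟨?_, ?_, ?_⟩, ?_, _, hdown,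
      Or.inr ⟨rfl, hcompl.symm⟩⟩
    · exact Fin.forall_fin_two.mpr ⟨hT, hI⟩
    · simp [Fin.forall_fin_two, hdisj, hdisj.symm]
    · exact fun v => Fin.exists_fin_two.mpr (hcover v).symm
    · exact Fin.forall_fin_two.mpr ⟨Fin.forall_fin_two.mpr ⟨hselfT 0, hTI⟩,
        Fin.forall_fin_two.mpr
          ⟨he.envyFreeUpToOne_terminalSegment (hmono 1) hk h, hselfI 1⟩⟩
end

section
/- Let G = (V, E) be a connected finite graph containing a vertex s whose removal leaves at least three connected components. Then there exist identical, additive, binary valuations for two agents (i.e., both agents share one additive valuation with singleton values in {0,1}) such that no connected allocation of G to the two agents satisfies EF1. -/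
variable {V : Type*}

/-- Two vertices of a connected bundle avoiding `s` are reachable from each other in `G - s`. -/
lemma GConnBundle.reachable_induce_compl {V : Type*} {G : SimpleGraph V} {I : Finset V}
    (hI : GConnBundle G I) {s : V} (hs : s ∉ I) {x y : (({s}ᶜ : Set V))}
    (hx : (x : V) ∈ I) (hy : (y : V) ∈ I) :
    (G.induce ({s}ᶜ : Set V)).Reachable x y := by
  have hle : (I : Set V) ≤ ({s}ᶜ : Set V) := fun v hv h => hs (by
    rw [Set.mem_singleton_iff] at h
    exact h ▸ hv)
  exact (hI ⟨x, hx⟩ ⟨y, hy⟩).map (SimpleGraph.induceHomOfLE G hle).toHom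

/-- if `G` is a connected finite graph with a vertex `s` whose removal leaves
at least three connected components (witnessed by three pairwise unreachable vertices of
`G - s`), then there are identical, additive, binary valuations for two agents such that
no connected allocation is EF1. -/
theorem trident_no_EF1 {V : Type*} [Fintype V] [DecidableEq V]
    (G : SimpleGraph V) (hconn : G.Connected) (s : V)
    (h3 : ∃ a b c : (({s}ᶜ : Set V)),
        ¬ (G.induce ({s}ᶜ : Set V)).Reachable a b ∧
        ¬ (G.induce ({s}ᶜ : Set V)).Reachable a c ∧
        ¬ (G.induce ({s}ᶜ : Set V)).Reachable b c) :
    ∃ w : V → ℝ, (∀ v, w v = 0 ∨ w v = 1) ∧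
      ∀ A : Fin 2 → Finset V, GConnAlloc G A →
        ¬ GEF1 G (fun _ I => ∑ v ∈ I, w v) A := by
  obtain ⟨a, b, c, hab, hac, hbc⟩ := h3
  have hab' : (a : V) ≠ b := fun h => hab (Subtype.ext h ▸ .refl a)
  have hac' : (a : V) ≠ c := fun h => hac (Subtype.ext h ▸ .refl a)
  have hbc' : (b : V) ≠ c := fun h => hbc (Subtype.ext h ▸ .refl b)
  have hsa : s ≠ a := fun h => a.2 h.symm
  have hsb : s ≠ b := fun h => b.2 h.symm
  have hsc : s ≠ c := fun h => c.2 h.symm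
  set T : Finset V := {s, (a : V), (b : V), (c : V)} with hT
  have hTcard : T.card = 4 := by
    simp [hT, hab', hac', hbc', hsa, hsb, hsc]
  refine ⟨fun v => if v ∈ T then 1 else 0, fun v => by by_cases h : v ∈ T <;> simp [h], ?_⟩
  rintro A ⟨hA, hdisj, hcov⟩ hEF
  have hsum : ∀ I : Finset V, ∑ v ∈ I, (if v ∈ T then (1 : ℝ) else 0) = ((T ∩ I).card : ℝ) := by
    intro I
    rw [Finset.sum_boole, Finset.filter_mem_eq_inter, Finset.inter_comm]
  obtain ⟨i, hi⟩ := hcov s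
  obtain ⟨j, hij, hcov'⟩ : ∃ j : Fin 2, i ≠ j ∧ ∀ k, k = i ∨ k = j := by
    exact ⟨1 - i, by lia, fun k => by lia⟩
  have hsj : s ∉ A j := Finset.disjoint_left.mp (hdisj i j hij) hi
  have hj : (T ∩ A j).card ≤ 1 := by
    have key := fun x y => (hA j).reachable_induce_compl hsj (x := x) (y := y)
    rw [Finset.card_le_one]
    intro x hx y hy
    simp only [hT, Finset.mem_inter, Finset.mem_insert, Finset.mem_singleton] at hx hy
    obtain ⟨hx, hxj⟩ := hx
    obtain ⟨hy, hyj⟩ := hy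
    rcases hx with rfl | rfl | rfl | rfl <;> rcases hy with rfl | rfl | rfl | rfl <;>
      first
      | rfl
      | exact absurd hxj hsj
      | exact absurd hyj hsj
      | exact absurd (key _ _ hxj hyj) ‹_›
      | exact absurd (key _ _ hyj hxj) ‹_›
  have hT_le : T.card ≤ (T ∩ A i).card + (T ∩ A j).card := by
    refine (Finset.card_le_card fun v hv => ?_).trans (Finset.card_union_le _ _)
    obtain ⟨k, hk⟩ := hcov v
    rcases hcov' k with rfl | rfl <;> simp [hv, hk]
  rcases hEF j i with h | ⟨v, -, -, hle⟩
  · simp [h] at hi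
  · simp only [hsum, Nat.cast_le] at hle
    have h1 : (T ∩ A i).card - 1 ≤ (T ∩ (A i \ {v})).card := by
      rw [← Finset.inter_sdiff_assoc, ← Finset.erase_eq]
      exact Finset.pred_card_le_card_erase
    omega
end

section
/- Let G = (V, E) be a connected finite graph that does not admit a bipolar numbering. Then there exist identical, additive, binary valuations for two agents such that no connected allocation of G to the two agents satisfies EF1. -/
variable {V : Type*}

/-- Every cut of `S` into two nonempty parts is crossed by an edge. -/
def CutConnected (G : SimpleGraph V) (S : Finset V) : Prop :=
  ∀ U ⊆ S, U.Nonempty → (∃ b ∈ S, b ∉ U) → ∃ a ∈ U, ∃ b ∈ S, b ∉ U ∧ G.Adj a b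

theorem gConnBundle_iff_cutConnected (G : SimpleGraph V) (S : Finset V) :
    GConnBundle G S ↔ CutConnected G S := by
  classical
  constructor
  · rintro h U hU ⟨a, ha⟩ ⟨b, hb, hbU⟩
    obtain ⟨p⟩ := h ⟨a, hU ha⟩ ⟨b, hb⟩
    obtain ⟨d, -, h1, h2⟩ := p.exists_boundary_dart {x | x.1 ∈ U} ha hbU
    exact ⟨d.fst, h1, d.snd, d.snd.2, h2, d.adj⟩
  · rintro h ⟨a, ha⟩ ⟨b, hb⟩
    by_contra hab
    obtain ⟨x, hx, y, hy, hyU, hxy⟩ :=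
      h (S.filter fun x => ∃ hx : x ∈ S, (G.induce (↑S : Set V)).Reachable ⟨a, ha⟩ ⟨x, hx⟩)
        (Finset.filter_subset _ _)
        ⟨a, Finset.mem_filter.2 ⟨ha, ha, SimpleGraph.Reachable.refl _⟩⟩
        ⟨b, hb, fun hmem => hab (Finset.mem_filter.1 hmem).2.2⟩
    obtain ⟨hxS, _, hr⟩ := Finset.mem_filter.1 hx
    refine hyU (Finset.mem_filter.2 ⟨hy, hy, hr.trans (SimpleGraph.Adj.reachable ?_)⟩)
    exact hxy

theorem cutConnected_of_subsingleton (G : SimpleGraph V) {S : Finset V}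
    (h : ∀ a ∈ S, ∀ b ∈ S, a = b) : CutConnected G S := by
  rintro U hU ⟨a, ha⟩ ⟨b, hb, hbU⟩
  exact absurd (h a (hU ha) b hb ▸ ha) hbU

theorem cutConnected_univ [Fintype V] {G : SimpleGraph V} (hG : G.Connected) :
    CutConnected G Finset.univ := by
  rintro U - ⟨a, ha⟩ ⟨b, -, hbU⟩
  obtain ⟨p⟩ := hG.preconnected a b
  obtain ⟨d, -, h1, h2⟩ := p.exists_boundary_dart {x | x ∈ U} ha hbU
  exact ⟨d.fst, h1, d.snd, Finset.mem_univ _, h2, d.adj⟩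

theorem CutConnected.insert [DecidableEq V] {G : SimpleGraph V} {S : Finset V} {x y : V}
    (hS : CutConnected G S) (hy : y ∈ S) (hxy : G.Adj x y) : CutConnected G (insert x S) := by
  rintro U hU ⟨a, ha⟩ ⟨b, hb, hbU⟩
  by_cases h1 : ∃ c ∈ S, c ∈ U
  · by_cases h2 : ∃ c ∈ S, c ∉ U
    · obtain ⟨c, hc, hcU⟩ := h1
      obtain ⟨d, hd, hdU⟩ := h2
      obtain ⟨p, hp, q, hq, hqU, hpq⟩ := hS (U ∩ S) Finset.inter_subset_right
        ⟨c, Finset.mem_inter.2 ⟨hcU, hc⟩⟩ ⟨d, hd, by simp [hdU]⟩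
      exact ⟨p, (Finset.mem_inter.1 hp).1, q, Finset.mem_insert_of_mem hq,
        fun h => hqU (Finset.mem_inter.2 ⟨h, hq⟩), hpq⟩
    · push Not at h2
      obtain rfl : b = x := by grind
      exact ⟨y, h2 y hy, b, hb, hbU, hxy.symm⟩
  · push Not at h1
    obtain rfl : a = x := by grind
    exact ⟨a, ha, y, Finset.mem_insert_of_mem hy, h1 y hy, hxy⟩

/-- Within `R`, the nonempty set `C` has no neighbour outside itself other than `v`. -/
structure AttachedAt (G : SimpleGraph V) (R C : Finset V) (v : V) : Prop where
  nonempty : C.Nonempty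
  subset : C ⊆ R
  mem : v ∈ R
  notMem : v ∉ C
  eq_of_adj : ∀ a ∈ C, ∀ b ∈ R, b ∉ C → G.Adj a b → b = v

theorem CutConnected.sdiff_of_attachedAt [DecidableEq V] {G : SimpleGraph V} {R C : Finset V}
    {v : V} (hR : CutConnected G R) (hC : AttachedAt G R C v) : CutConnected G (R \ C) := by
  rintro U hU ⟨a, ha⟩ ⟨b, hb, hbU⟩
  have key := hC.eq_of_adj
  have hU' : ∀ x ∈ U, x ∈ R ∧ x ∉ C := fun x hx => Finset.mem_sdiff.1 (hU hx)
  by_cases hv : v ∈ U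
  · obtain ⟨p, hp, q, hq, hqU, hpq⟩ := hR ((R \ C) \ U) (by grind)
      ⟨b, Finset.mem_sdiff.2 ⟨hb, hbU⟩⟩ ⟨a, (hU' a ha).1, by grind⟩
    have := hpq.symm
    exact ⟨q, by grind, p, by grind, by grind, this⟩
  · obtain ⟨p, hp, q, hq, hqU, hpq⟩ := hR U (fun x hx => (hU' x hx).1) ⟨a, ha⟩
      ⟨b, (Finset.mem_sdiff.1 hb).1, hbU⟩
    have := hpq.symm
    exact ⟨p, hp, q, by grind, hqU, hpq⟩

/-- A connected set `R` other than `{t}` can be shrunk by a vertex that has a neighbour outside. -/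
theorem exists_removable [Fintype V] [DecidableEq V] {G : SimpleGraph V} {t : V} {R : Finset V}
    (hflap : ∀ C v, t ∉ C → C ⊆ R → ¬ AttachedAt G Finset.univ C v)
    (hR : CutConnected G R) (ht : t ∈ R) (hne : ∃ x ∈ R, x ≠ t) :
    ∃ x ∈ R, x ≠ t ∧ (∃ y, y ∉ R ∧ G.Adj x y) ∧ CutConnected G (R.erase x) := by
  have hex : ∃ C, t ∉ C ∧ ∃ v, AttachedAt G R C v := by
    obtain ⟨x, hx, hxt⟩ := hne
    exact ⟨R.erase t, by simp, t, ⟨x, by simp [hx, hxt]⟩, Finset.erase_subset _ _, ht, by simp,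
      by grind⟩
  obtain ⟨C, ⟨htC, v, hC⟩, hmin⟩ := exists_minimal_of_wellFoundedLT _ hex
  have hx : ∃ x ∈ C, ∃ y, y ∉ R ∧ G.Adj x y := by
    by_contra! hcon
    refine hflap C v htC hC.subset
      ⟨hC.nonempty, Finset.subset_univ _, Finset.mem_univ _, hC.notMem, ?_⟩
    intro a ha b _ hb hab
    by_cases hbR : b ∈ R
    · exact hC.eq_of_adj a ha b hbR hb hab
    · exact absurd hab (hcon a ha b hbR)
  obtain ⟨x, hxC, hxout⟩ := hx
  have hrest := hR.sdiff_of_attachedAt hC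
  have hsub := hC.subset
  have key : ∀ U ⊆ R.erase x, U.Nonempty → t ∉ U →
      ∃ a ∈ U, ∃ b ∈ R.erase x, b ∉ U ∧ G.Adj a b := by
    intro U hU hUne htU
    by_contra! hcon
    have hatt : AttachedAt G R U x := ⟨hUne, hU.trans (Finset.erase_subset _ _), hsub hxC,
      fun h => by simpa using hU h, fun a ha b hb hbU hab => by
        by_contra hbx
        exact hcon a ha b (Finset.mem_erase.2 ⟨hbx, hb⟩) hbU hab⟩
    have hUC : U ⊆ C := by
      intro z hz
      by_contra hzC
      obtain ⟨p, hp, q, hq, hqU, hpq⟩ := hrest (U \ C) (by grind) ⟨z, by grind⟩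
        ⟨t, by grind, by grind⟩
      exact hcon p (by grind) q (by grind) (by grind) hpq
    exact hatt.notMem (hmin ⟨htU, x, hatt⟩ hUC hxC)
  refine ⟨x, hsub hxC, by grind, hxout, ?_⟩
  rintro U hU hUne ⟨b, hb, hbU⟩
  by_cases htU : t ∈ U
  · obtain ⟨p, hp, q, hq, hqU, hpq⟩ := key ((R.erase x) \ U) Finset.sdiff_subset
      ⟨b, by grind⟩ (by grind)
    exact ⟨q, by grind, p, by grind, by grind, hpq.symm⟩
  · exact key U hU hUne htU

/-- If `A` is the complement of `R` and both are connected, then `R` can be listed so that every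
prefix joined to `A`, and every suffix, is connected. -/
theorem exists_list_of_no_flap [Fintype V] [DecidableEq V] {G : SimpleGraph V} {t : V}
    (hG : CutConnected G Finset.univ) (n : ℕ) :
    ∀ R A : Finset V, R.card = n → t ∈ R → (∀ v, v ∈ A ↔ v ∉ R) →
    (∀ C v, t ∉ C → C ⊆ R → ¬ AttachedAt G Finset.univ C v) →
    CutConnected G R → CutConnected G A →
    ∃ l : List V, l.Nodup ∧ (∀ v, v ∈ l ↔ v ∈ R) ∧
      ∀ j, CutConnected G (A ∪ (l.take j).toFinset) ∧ CutConnected G (l.drop j).toFinset := by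
  induction n with
  | zero =>
    intro R A hcard ht
    simp_all
  | succ n ih =>
    intro R A hcard ht hA hflap hR hAc
    by_cases hne : ∃ x ∈ R, x ≠ t
    · obtain ⟨x, hxR, hxt, ⟨y, hyR, hxy⟩, hR'⟩ := exists_removable hflap hR ht hne
      obtain ⟨l, hnd, hl, hc⟩ := ih (R.erase x) (insert x A)
        (by rw [Finset.card_erase_of_mem hxR, hcard]; rfl) (by grind) (by grind)
        (fun C v htC hC => hflap C v htC (hC.trans (Finset.erase_subset _ _))) hR'
        (hAc.insert ((hA y).2 hyR) hxy)
      refine ⟨x :: l, by simp [hnd, hl], by grind, ?_⟩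
      rintro (_ | j)
      · refine ⟨by simpa using hAc, ?_⟩
        convert hR using 1
        ext v
        simp only [List.drop_zero, List.mem_toFinset, List.mem_cons, hl, Finset.mem_erase]
        grind
      · refine ⟨?_, by simpa using (hc j).2⟩
        convert (hc j).1 using 1
        ext v
        simp only [List.take_succ_cons, List.toFinset_cons, Finset.mem_union, Finset.mem_insert]
        tauto
    · push Not at hne
      refine ⟨[t], by simp, by grind, ?_⟩
      rintro (_ | j)
      · refine ⟨by simpa using hAc, cutConnected_of_subsingleton G (by simp)⟩
      · refine ⟨?_, cutConnected_of_subsingleton G (by simp)⟩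
        convert hG using 1
        ext v
        have := hA v
        simp only [List.take_succ_cons, List.take_nil, Finset.mem_union, List.mem_toFinset,
          List.mem_singleton, Finset.mem_univ, iff_true]
        grind

theorem bipolarNumbering_of_list [Fintype V] [DecidableEq V] {G : SimpleGraph V} (l : List V)
    (hnd : l.Nodup) (hmem : ∀ v, v ∈ l)
    (hl : ∀ j, CutConnected G (l.take j).toFinset ∧ CutConnected G (l.drop j).toFinset) :
    ∃ e : Fin (Fintype.card V) ≃ V, BipolarNumbering G e := by
  have hlen : Fintype.card V = l.length := by
    rw [← List.toFinset_card_of_nodup hnd, ← Finset.card_univ]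
    congr 1
    ext v
    simp [hmem]
  refine ⟨(finCongr hlen).trans (hnd.getEquivOfForallMemList l hmem), fun j => ?_⟩
  simp only [gConnBundle_iff_cutConnected]
  constructor
  · convert (hl (j + 1)).1 using 1
    ext v
    simp only [Finset.mem_image, Finset.mem_Iic, List.mem_toFinset, List.mem_take_iff_getElem]
    constructor
    · rintro ⟨i, hi, rfl⟩
      exact ⟨i, by have := i.2; have : i.1 ≤ j.1 := hi; omega, rfl⟩
    · rintro ⟨i, hi, rfl⟩
      exact ⟨⟨i, by omega⟩, by change i ≤ j.1; omega, rfl⟩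
  · convert (hl j).2 using 1
    ext v
    simp only [Finset.mem_image, Finset.mem_Ici, List.mem_toFinset, List.mem_drop_iff_getElem]
    constructor
    · rintro ⟨i, hi, rfl⟩
      have hi' : j.1 ≤ i.1 := hi
      refine ⟨i - j, by have := i.2; omega, ?_⟩
      simp [Nat.add_sub_cancel' hi']
    · rintro ⟨i, hi, rfl⟩
      exact ⟨⟨j + i, by omega⟩, by change j.1 ≤ j.1 + i; omega, rfl⟩

theorem exists_bipolarNumbering [Fintype V] [DecidableEq V] {G : SimpleGraph V} {s t : V}
    (hG : CutConnected G Finset.univ) (hst : s ≠ t)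
    (hflap : ∀ C v, s ∉ C → t ∉ C → ¬ AttachedAt G Finset.univ C v) :
    ∃ e : Fin (Fintype.card V) ≃ V, BipolarNumbering G e := by
  have key : ∀ U ⊆ Finset.univ.erase s, U.Nonempty → t ∉ U →
      ∃ a ∈ U, ∃ b ∈ Finset.univ.erase s, b ∉ U ∧ G.Adj a b := by
    intro U hU hUne htU
    by_contra! hcon
    have hsU : s ∉ U := fun h => by simpa using hU h
    refine hflap U s hsU htU ⟨hUne, Finset.subset_univ _, Finset.mem_univ _, hsU, ?_⟩
    intro a ha b _ hbU hab
    by_contra hbs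
    exact hcon a ha b (by simp [hbs]) hbU hab
  have hR : CutConnected G (Finset.univ.erase s) := by
    rintro U hU hUne ⟨b, hb, hbU⟩
    by_cases htU : t ∈ U
    · obtain ⟨p, hp, q, hq, hqU, hpq⟩ := key ((Finset.univ.erase s) \ U) Finset.sdiff_subset
        ⟨b, by grind⟩ (by grind)
      exact ⟨q, by grind, p, by grind, by grind, hpq.symm⟩
    · exact key U hU hUne htU
  obtain ⟨l, hnd, hl, hc⟩ := exists_list_of_no_flap hG _ (Finset.univ.erase s) {s} rfl
    (by simp [hst.symm]) (by simp)
    (fun C v htC hC => hflap C v (fun h => by simpa using hC h) htC) hR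
    (cutConnected_of_subsingleton G (by simp))
  refine bipolarNumbering_of_list (s :: l) (by simp [hl, hnd]) (by simp [hl, em]) ?_
  rintro (_ | j)
  · refine ⟨cutConnected_of_subsingleton G (by simp), ?_⟩
    convert hG using 1
    ext v
    simp [hl, em]
  · refine ⟨?_, by simpa using (hc j).2⟩
    rw [List.take_succ_cons, List.toFinset_cons, Finset.insert_eq]
    exact (hc j).1

/-- `C` is attached at `v`, and `v` is not the only vertex outside `C`. -/
def IsFlap [Fintype V] (G : SimpleGraph V) (C : Finset V) : Prop :=
  ∃ v, AttachedAt G Finset.univ C v ∧ ∃ w, w ≠ v ∧ w ∉ C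

theorem IsFlap.cutConnected_of_minimal [Fintype V] [DecidableEq V] {G : SimpleGraph V}
    {C : Finset V} (hC : Minimal (IsFlap G) C) : CutConnected G C := by
  obtain ⟨⟨v, hv, w, hwv, hwC⟩, hmin⟩ := hC
  intro U hU hUne hb
  by_contra! hcon
  have hvC := hv.notMem
  have hadj := hv.eq_of_adj
  obtain ⟨b, hbC, hbU⟩ := hb
  refine hbU (hmin ⟨v, ⟨hUne, Finset.subset_univ _, Finset.mem_univ _, fun h => hvC (hU h), ?_⟩,
    w, hwv, fun h => hwC (hU h)⟩ hU hbC)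
  intro a ha c hc hcU hac
  by_cases hcC : c ∈ C
  · exact absurd hac (hcon a ha c hcC hcU)
  · exact hadj a (hU ha) c hc hcC hac

theorem AttachedAt.subset_of_mem [DecidableEq V] {G : SimpleGraph V} {R S C : Finset V} {v x : V}
    (hC : AttachedAt G R C v) (hSR : S ⊆ R) (hS : CutConnected G S) (hvS : v ∉ S) (hx : x ∈ S)
    (hxC : x ∈ C) : S ⊆ C := by
  intro y hy
  by_contra hyC
  obtain ⟨a, ha, b, hb, hbC, hab⟩ := hS (S ∩ C) Finset.inter_subset_left
    ⟨x, Finset.mem_inter.2 ⟨hx, hxC⟩⟩ ⟨y, hy, fun h => hyC (Finset.mem_inter.1 h).2⟩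
  exact hvS (hC.eq_of_adj a (Finset.mem_inter.1 ha).2 b (hSR hb)
    (fun h => hbC (Finset.mem_inter.2 ⟨hb, h⟩)) hab ▸ hb)

/-- Distinct minimal flaps cannot contain each other's attachment vertices. -/
theorem false_of_mem_of_mem [Fintype V] [DecidableEq V] {G : SimpleGraph V} {C D : Finset V}
    {v w : V} (hG : CutConnected G Finset.univ) (hD : Minimal (IsFlap G) D)
    (hv : AttachedAt G Finset.univ C v) (hC : IsFlap G C) (hw : AttachedAt G Finset.univ D w)
    (hvD : v ∈ D) (hwC : w ∈ C) : False := by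
  have hsub := hv.subset_of_mem (Finset.subset_univ _) (hG.sdiff_of_attachedAt hw)
    (by simp [hvD]) (x := w) (by simp [hw.notMem]) hwC
  have hadj := hv.eq_of_adj
  have hvC := hv.notMem
  have hcov : ∀ x, x ∉ D → x ∈ C := fun x hx => hsub (by simp [hx])
  have hout : ∃ z, z ≠ v ∧ z ∉ C := by
    obtain ⟨v', hv', z, hz, hzC⟩ := hC
    by_cases hzv : z = v
    · exact ⟨v', fun h => hz (hzv.trans h.symm), hv'.notMem⟩
    · exact ⟨z, hzv, hzC⟩
  obtain ⟨z, hzv, hzC⟩ := hout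
  refine absurd (hD.2 (y := (Finset.univ \ C).erase v) ⟨v, ⟨⟨z, by simp [hzv, hzC]⟩,
    Finset.subset_univ _, Finset.mem_univ _, by simp, ?_⟩, w, ?_, by simp [hwC]⟩ ?_ hvD)
    (by simp)
  · intro a ha b _ hb hab
    by_contra hbv
    have hbC : b ∈ C := by simpa [hbv] using hb
    simp only [Finset.mem_erase, Finset.mem_sdiff, Finset.mem_univ, true_and] at ha
    exact ha.1 (hadj b hbC a (Finset.mem_univ _) ha.2 hab.symm)
  · rintro rfl
    exact hvC hwC
  · intro x hx
    by_contra hxD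
    have := hcov x hxD
    simp [this] at hx

theorem disjoint_of_minimal_flaps [Fintype V] [DecidableEq V] {G : SimpleGraph V}
    {C D : Finset V} {v w : V} (hG : CutConnected G Finset.univ) (hC : Minimal (IsFlap G) C)
    (hD : Minimal (IsFlap G) D) (hv : AttachedAt G Finset.univ C v)
    (hw : AttachedAt G Finset.univ D w) (hne : C ≠ D) :
    (∀ x ∈ C, x ∉ D) ∧ v ∉ D ∧ w ∉ C := by
  have hdisj : ∀ x ∈ C, x ∉ D := by
    intro x hxC hxD
    by_cases hvD : v ∈ D
    · by_cases hwC : w ∈ C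
      · exact false_of_mem_of_mem hG hD hv hC.1 hw hvD hwC
      · have hCD := hw.subset_of_mem (Finset.subset_univ _)
          (IsFlap.cutConnected_of_minimal hC) hwC hxC hxD
        exact hne (le_antisymm hCD (hD.2 hC.1 hCD))
    · have hDC := hv.subset_of_mem (Finset.subset_univ _)
        (IsFlap.cutConnected_of_minimal hD) hvD hxD hxC
      exact hne (le_antisymm (hC.2 hD.1 hDC) hDC)
  have hmem : ∀ {C D : Finset V} {v w : V}, Minimal (IsFlap G) D → AttachedAt G Finset.univ C v →
      IsFlap G C → AttachedAt G Finset.univ D w → (∀ x ∈ C, x ∉ D) → v ∉ D := by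
    intro C D v w hD hv hC hw hdisj hvD
    obtain ⟨a, ha, b, hb, hbC, hab⟩ := hG C (Finset.subset_univ _) hv.nonempty
      ⟨v, Finset.mem_univ _, hv.notMem⟩
    obtain rfl := hv.eq_of_adj a ha b hb hbC hab
    obtain rfl := hw.eq_of_adj b hvD a (Finset.mem_univ _) (hdisj a ha) hab.symm
    exact false_of_mem_of_mem hG hD hv hC hw hvD ha
  exact ⟨hdisj, hmem hD hv hC.1 hw hdisj, hmem hC hw hD.1 hv fun x hx h => hdisj x h hx⟩

/-- In an EF1 allocation under identical binary valuations the bundle values differ by at most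
one. -/
theorem card_inter_le_of_gEF1 {n : ℕ} [DecidableEq V] {G : SimpleGraph V} {T : Finset V}
    {A : Fin n → Finset V}
    (hA : GEF1 G (fun _ I => ∑ v ∈ I, if v ∈ T then (1 : ℝ) else 0) A) (i j : Fin n) :
    (T ∩ A j).card ≤ (T ∩ A i).card + 1 := by
  have hsum : ∀ I : Finset V, (∑ v ∈ I, if v ∈ T then (1 : ℝ) else 0) = (T ∩ I).card := by
    intro I
    rw [Finset.sum_boole, Finset.filter_mem_eq_inter, Finset.inter_comm]
  obtain h | ⟨v, hv, -, h⟩ := hA i j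
  · simp [h]
  · simp only [hsum, Nat.cast_le] at h
    have hsub : T ∩ A j ⊆ insert v (T ∩ (A j \ {v})) := by grind
    have := (Finset.card_le_card hsub).trans (Finset.card_insert_le _ _)
    omega

theorem gConnAlloc_two {G : SimpleGraph V} {A : Fin 2 → Finset V} (hA : GConnAlloc G A) :
    CutConnected G (A 0) ∧ CutConnected G (A 1) ∧ ∀ v, v ∈ A 1 ↔ v ∉ A 0 := by
  obtain ⟨hc, hd, hcov⟩ := hA
  refine ⟨(gConnBundle_iff_cutConnected G _).1 (hc 0), (gConnBundle_iff_cutConnected G _).1 (hc 1),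
    fun v => ⟨fun h h' => Finset.disjoint_left.1 (hd 0 1 (by decide)) h' h, fun h => ?_⟩⟩
  obtain ⟨i, hi⟩ := hcov v
  fin_cases i
  · exact absurd hi h
  · exact hi

theorem card_inter_eq_sum [DecidableEq V] (T X : Finset V) :
    (T ∩ X).card = ∑ v ∈ T, if v ∈ X then 1 else 0 := by
  rw [← Finset.filter_mem_eq_inter, Finset.card_filter]

theorem not_gEF1_of_star [DecidableEq V] {G : SimpleGraph V} {v a b c : V}
    (hdist : [v, a, b, c].Nodup)
    (hsep : ∀ X, CutConnected G X → v ∉ X →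
      ¬(a ∈ X ∧ b ∈ X) ∧ ¬(a ∈ X ∧ c ∈ X) ∧ ¬(b ∈ X ∧ c ∈ X))
    {A : Fin 2 → Finset V} (hA : GConnAlloc G A) :
    ¬ GEF1 G (fun _ I => ∑ x ∈ I, if x ∈ ({v, a, b, c} : Finset V) then (1 : ℝ) else 0) A := by
  intro hEF
  obtain ⟨h0, h1, hcompl⟩ := gConnAlloc_two hA
  have h01 := card_inter_le_of_gEF1 hEF 0 1
  have h10 := card_inter_le_of_gEF1 hEF 1 0
  simp only [List.nodup_cons, List.mem_cons, List.not_mem_nil, or_false, not_or] at hdist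
  obtain ⟨⟨d1, d2, d3⟩, ⟨d4, d5⟩, d6, -⟩ := hdist
  have hs0 := hsep _ h0
  have hs1 := hsep _ h1
  simp only [hcompl] at hs1
  simp only [card_inter_eq_sum, hcompl] at h01 h10
  rw [Finset.sum_insert (by simp [*]), Finset.sum_insert (by simp [*]),
    Finset.sum_insert (by simp [*]), Finset.sum_singleton, Finset.sum_insert (by simp [*]),
    Finset.sum_insert (by simp [*]), Finset.sum_insert (by simp [*]),
    Finset.sum_singleton] at h01 h10
  by_cases v ∈ A 0 <;> by_cases a ∈ A 0 <;> by_cases b ∈ A 0 <;> by_cases c ∈ A 0 <;> simp_all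

theorem not_gEF1_of_three_pendants [DecidableEq V] {G : SimpleGraph V} {u v w a b c : V}
    (hdist : [u, v, w, a, b, c].Nodup)
    (hsep : ∀ X, CutConnected G X → (a ∈ X → b ∈ X → u ∈ X ∧ v ∈ X) ∧
      (a ∈ X → c ∈ X → u ∈ X ∧ w ∈ X) ∧ (b ∈ X → c ∈ X → v ∈ X ∧ w ∈ X))
    {A : Fin 2 → Finset V} (hA : GConnAlloc G A) :
    ¬ GEF1 G (fun _ I => ∑ x ∈ I, if x ∈ ({u, v, w, a, b, c} : Finset V) then (1 : ℝ) else 0)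
      A := by
  intro hEF
  obtain ⟨h0, h1, hcompl⟩ := gConnAlloc_two hA
  have h01 := card_inter_le_of_gEF1 hEF 0 1
  have h10 := card_inter_le_of_gEF1 hEF 1 0
  simp only [List.nodup_cons, List.mem_cons, List.not_mem_nil, or_false, not_or] at hdist
  obtain ⟨⟨d1, d2, d3, d4, d5⟩, ⟨d6, d7, d8, d9⟩, ⟨e1, e2, e3⟩, ⟨e4, e5⟩, e6, -⟩ := hdist
  have hs0 := hsep _ h0
  have hs1 := hsep _ h1
  simp only [hcompl] at hs1
  simp only [card_inter_eq_sum, hcompl] at h01 h10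
  rw [Finset.sum_insert (by simp [*]), Finset.sum_insert (by simp [*]),
    Finset.sum_insert (by simp [*]), Finset.sum_insert (by simp [*]),
    Finset.sum_insert (by simp [*]), Finset.sum_singleton, Finset.sum_insert (by simp [*]),
    Finset.sum_insert (by simp [*]), Finset.sum_insert (by simp [*]),
    Finset.sum_insert (by simp [*]), Finset.sum_insert (by simp [*]),
    Finset.sum_singleton] at h01 h10
  clear hsep hEF hcompl
  by_cases u ∈ A 0 <;> by_cases v ∈ A 0 <;> by_cases w ∈ A 0 <;> by_cases a ∈ A 0 <;>
    by_cases b ∈ A 0 <;> by_cases c ∈ A 0 <;> simp_all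

theorem exists_not_gEF1_of_star [Fintype V] [DecidableEq V] {G : SimpleGraph V}
    {B C D : Finset V} {v : V} (hB : AttachedAt G Finset.univ B v)
    (hC : AttachedAt G Finset.univ C v) (hD : D.Nonempty) (hvD : v ∉ D)
    (hBC : ∀ x ∈ B, x ∉ C) (hBD : ∀ x ∈ B, x ∉ D) (hCD : ∀ x ∈ C, x ∉ D) :
    ∃ T : Finset V, ∀ A : Fin 2 → Finset V, GConnAlloc G A →
      ¬ GEF1 G (fun _ I => ∑ x ∈ I, if x ∈ T then (1 : ℝ) else 0) A := by
  obtain ⟨b, hb⟩ := hB.nonempty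
  obtain ⟨c, hc⟩ := hC.nonempty
  obtain ⟨d, hd⟩ := hD
  have hvB := hB.notMem
  have hvC := hC.notMem
  refine ⟨_, fun A hA => not_gEF1_of_star (v := v) (a := b) (b := c) (c := d) ?_ ?_ hA⟩
  · simp only [List.nodup_cons, List.mem_cons, List.not_mem_nil, or_false, not_or]
    grind
  · intro X hX hvX
    have h1 : b ∈ X → X ⊆ B := fun h => hB.subset_of_mem (Finset.subset_univ _) hX hvX h hb
    have h2 : c ∈ X → X ⊆ C := fun h => hC.subset_of_mem (Finset.subset_univ _) hX hvX h hc
    grind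

theorem exists_not_gEF1_of_three_pendants [Fintype V] [DecidableEq V] {G : SimpleGraph V}
    {B C D : Finset V} {u v w : V} (hB : AttachedAt G Finset.univ B u)
    (hC : AttachedAt G Finset.univ C v) (hD : AttachedAt G Finset.univ D w)
    (huv : u ≠ v) (huw : u ≠ w) (hvw : v ≠ w)
    (hBC : (∀ x ∈ B, x ∉ C) ∧ u ∉ C ∧ v ∉ B) (hBD : (∀ x ∈ B, x ∉ D) ∧ u ∉ D ∧ w ∉ B)
    (hCD : (∀ x ∈ C, x ∉ D) ∧ v ∉ D ∧ w ∉ C) :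
    ∃ T : Finset V, ∀ A : Fin 2 → Finset V, GConnAlloc G A →
      ¬ GEF1 G (fun _ I => ∑ x ∈ I, if x ∈ T then (1 : ℝ) else 0) A := by
  obtain ⟨b, hb⟩ := hB.nonempty
  obtain ⟨c, hc⟩ := hC.nonempty
  obtain ⟨d, hd⟩ := hD.nonempty
  have huB := hB.notMem
  have hvC := hC.notMem
  have hwD := hD.notMem
  refine ⟨_, fun A hA => not_gEF1_of_three_pendants (u := u) (v := v) (w := w) (a := b) (b := c)
    (c := d) ?_ ?_ hA⟩
  · simp only [List.nodup_cons, List.mem_cons, List.not_mem_nil, or_false, not_or]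
    refine ⟨?_, ?_, ?_, ?_, ?_, ?_⟩ <;> grind
  · intro X hX
    have h1 : u ∉ X → b ∈ X → X ⊆ B := fun h h' =>
      hB.subset_of_mem (Finset.subset_univ _) hX h h' hb
    have h2 : v ∉ X → c ∈ X → X ⊆ C := fun h h' =>
      hC.subset_of_mem (Finset.subset_univ _) hX h h' hc
    have h3 : w ∉ X → d ∈ X → X ⊆ D := fun h h' =>
      hD.subset_of_mem (Finset.subset_univ _) hX h h' hd
    grind

theorem exists_not_gEF1_of_three_minimal_flaps [Fintype V] [DecidableEq V] {G : SimpleGraph V}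
    (hG : CutConnected G Finset.univ) {B C D : Finset V} (hB : Minimal (IsFlap G) B)
    (hC : Minimal (IsFlap G) C) (hD : Minimal (IsFlap G) D) (hBC : B ≠ C) (hBD : B ≠ D)
    (hCD : C ≠ D) :
    ∃ T : Finset V, ∀ A : Fin 2 → Finset V, GConnAlloc G A →
      ¬ GEF1 G (fun _ I => ∑ x ∈ I, if x ∈ T then (1 : ℝ) else 0) A := by
  obtain ⟨u, hu, -⟩ := hB.1
  obtain ⟨v, hv, -⟩ := hC.1
  obtain ⟨w, hw, -⟩ := hD.1
  have huv := disjoint_of_minimal_flaps hG hB hC hu hv hBC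
  have huw := disjoint_of_minimal_flaps hG hB hD hu hw hBD
  have hvw := disjoint_of_minimal_flaps hG hC hD hv hw hCD
  by_cases h1 : u = v
  · subst h1
    exact exists_not_gEF1_of_star hu hv hw.nonempty huw.2.1 huv.1 huw.1 hvw.1
  by_cases h2 : u = w
  · subst h2
    exact exists_not_gEF1_of_star hu hw hv.nonempty huv.2.1 huw.1 huv.1
      fun x h h' => hvw.1 x h' h
  by_cases h3 : v = w
  · subst h3
    exact exists_not_gEF1_of_star hv hw hu.nonempty huv.2.2 hvw.1 (fun x h h' => huv.1 x h' h)
      fun x h h' => huw.1 x h' h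
  exact exists_not_gEF1_of_three_pendants hu hv hw h1 h2 h3 huv huw hvw

theorem exists_three_minimal_flaps [Fintype V] [DecidableEq V] {G : SimpleGraph V}
    (hG : CutConnected G Finset.univ)
    (hnb : ¬ ∃ e : Fin (Fintype.card V) ≃ V, BipolarNumbering G e) :
    ∃ B C D, Minimal (IsFlap G) B ∧ Minimal (IsFlap G) C ∧ Minimal (IsFlap G) D ∧
      B ≠ C ∧ B ≠ D ∧ C ≠ D := by
  have hnt : Nontrivial V := by
    by_contra hsub
    rw [not_nontrivial_iff_subsingleton] at hsub
    exact hnb ⟨(Fintype.equivFin V).symm, fun j => by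
      constructor <;> exact (gConnBundle_iff_cutConnected G _).2
        (cutConnected_of_subsingleton G fun a _ b _ => Subsingleton.elim a b)⟩
  have havoid : ∀ s t : V, s ≠ t → ∃ C, Minimal (IsFlap G) C ∧ s ∉ C ∧ t ∉ C := by
    intro s t hst
    by_contra! hcon
    refine hnb (exists_bipolarNumbering hG hst ?_)
    intro C v hsC htC hC
    have hflap : IsFlap G C := by
      by_cases hsv : s = v
      · exact ⟨v, hC, t, fun h => hst (hsv.trans h.symm), htC⟩
      · exact ⟨v, hC, s, hsv, hsC⟩
    obtain ⟨D, hDC, hD⟩ := exists_minimal_le_of_wellFoundedLT _ C hflap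
    exact htC (hDC (hcon D hD fun h => hsC (hDC h)))
  obtain ⟨x, y, hxy⟩ := exists_pair_ne V
  obtain ⟨B, hB, -⟩ := havoid x y hxy
  obtain ⟨s, hs⟩ : B.Nonempty := by
    obtain ⟨v, hv, -⟩ := hB.1
    exact hv.nonempty
  obtain ⟨y, hy⟩ := exists_ne s
  obtain ⟨C, hC, hsC, -⟩ := havoid s y hy.symm
  obtain ⟨t, ht⟩ : C.Nonempty := by
    obtain ⟨v, hv, -⟩ := hC.1
    exact hv.nonempty
  obtain ⟨D, hD, hsD, htD⟩ := havoid s t fun h => hsC (h ▸ ht)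
  exact ⟨B, C, D, hB, hC, hD, fun h => hsC (h ▸ hs), fun h => hsD (h ▸ hs), fun h => htD (h ▸ ht)⟩

/-- if a connected finite graph `G` does not admit a bipolar numbering, then
there are identical, additive, binary valuations for two agents such that no connected
allocation is EF1. -/
theorem no_bipolar_no_EF1 {V : Type*} [Fintype V] [DecidableEq V]
    (G : SimpleGraph V) (hconn : G.Connected)
    (hnb : ¬ ∃ e : Fin (Fintype.card V) ≃ V, BipolarNumbering G e) :
    ∃ w : V → ℝ, (∀ v, w v = 0 ∨ w v = 1) ∧
      ∀ A : Fin 2 → Finset V, GConnAlloc G A →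
        ¬ GEF1 G (fun _ I => ∑ v ∈ I, w v) A := by
  have hG := cutConnected_univ hconn
  obtain ⟨B, C, D, hB, hC, hD, hBC, hBD, hCD⟩ := exists_three_minimal_flaps hG hnb
  obtain ⟨T, hT⟩ := exists_not_gEF1_of_three_minimal_flaps hG hB hC hD hBC hBD hCD
  exact ⟨fun v => if v ∈ T then 1 else 0, fun v => by by_cases h : v ∈ T <;> simp [h], hT⟩
end

section
/- (Median Lumpy Ties Lemma) Let three agents have monotonic valuations over the connected bundles of a path, let P(v_s,v_r) = (v_s,…,v_r) be a contiguous subsequence of the path, let v_j be the median lumpy tie of the three agents over P(v_s,v_r), and let S = {i, k} be a set of two of the agents such that either (i is a left agent and k is a right agent) or (i is a middle agent). Then the allocation Lumpy(S, v_j, P(v_s,v_r)) of the items of P(v_s,v_r) to S — giving, in the first case, L(v_j) to i and R(v_j) ∪ {v_j} to k, and in the second case giving k his weakly preferred bundle among L(v_j) and R(v_j) and giving i the other bundle together with v_j — is an EF1 allocation of the items of P(v_s,v_r) among the two agents in S; furthermore, each agent in S receives a bundle they weakly prefer to both L(v_j) and R(v_j). -/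
theorem isInterval_Ico {m : ℕ} (a b : Fin m) : IsInterval (Finset.Ico a b) := by
  intro x y z hxy hyz hx hz
  simp only [Finset.mem_Ico] at *
  exact ⟨hx.1.trans hxy, hyz.trans_lt hz.2⟩

theorem isInterval_Ioc {m : ℕ} (a b : Fin m) : IsInterval (Finset.Ioc a b) := by
  intro x y z hxy hyz hx hz
  simp only [Finset.mem_Ioc] at *
  exact ⟨hx.1.trans_le hxy, hyz.trans hz.2⟩

theorem isInterval_Icc {m : ℕ} (a b : Fin m) : IsInterval (Finset.Icc a b) := by
  intro x y z hxy hyz hx hz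
  simp only [Finset.mem_Icc] at *
  exact ⟨hx.1.trans hxy, hyz.trans hz.2⟩

/-- An agent who weakly prefers their own bundle to an interval is not envious of it up to one
item: an end of the interval can be removed. -/
theorem Ico_eq_empty_or_exists_removable {m : ℕ} {u : Finset (Fin m) → ℝ} (hu : Monotonic u)
    (a b : Fin m) {c : ℝ} (h : u (Finset.Ico a b) ≤ c) :
    Finset.Ico a b = ∅ ∨ ∃ v ∈ Finset.Ico a b,
      IsInterval (Finset.Ico a b \ {v}) ∧ u (Finset.Ico a b \ {v}) ≤ c := by
  rcases lt_or_ge a b with hab | hab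
  · refine Or.inr ⟨a, Finset.left_mem_Ico.2 hab, ?_, (hu _ _ Finset.sdiff_subset).trans h⟩
    intro x y z hxy hyz hx hz
    simp only [Finset.mem_sdiff, Finset.mem_Ico, Finset.mem_singleton] at *
    grind
  · exact Or.inl (Finset.Ico_eq_empty_of_le hab)

/-- The analogue of `Ico_eq_empty_or_exists_removable` for intervals `Finset.Ioc a b`. -/
theorem Ioc_eq_empty_or_exists_removable {m : ℕ} {u : Finset (Fin m) → ℝ} (hu : Monotonic u)
    (a b : Fin m) {c : ℝ} (h : u (Finset.Ioc a b) ≤ c) :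
    Finset.Ioc a b = ∅ ∨ ∃ v ∈ Finset.Ioc a b,
      IsInterval (Finset.Ioc a b \ {v}) ∧ u (Finset.Ioc a b \ {v}) ≤ c := by
  rcases lt_or_ge a b with hab | hab
  · refine Or.inr ⟨b, Finset.right_mem_Ioc.2 hab, ?_, (hu _ _ Finset.sdiff_subset).trans h⟩
    intro x y z hxy hyz hx hz
    simp only [Finset.mem_sdiff, Finset.mem_Ioc, Finset.mem_singleton] at *
    grind
  · exact Or.inl (Finset.Ioc_eq_empty_of_le hab)

/-- An agent whose tie `t` lies strictly before `j` weakly prefers the items before `j` to the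
items from `j` on. -/
theorem value_insert_Ioc_le_value_Ico {m : ℕ} {u : Finset (Fin m) → ℝ} (hu : Monotonic u)
    {s t j r : Fin m} (hst : s ≤ t) (htj : t < j) (hjr : j ≤ r)
    (h : u (Finset.Ioc t r) ≤ u (insert t (Finset.Ico s t))) :
    u (insert j (Finset.Ioc j r)) ≤ u (Finset.Ico s j) := by
  refine ((hu _ _ ?_).trans h).trans (hu _ _ ?_)
  all_goals
    intro x hx
    simp only [Finset.mem_insert, Finset.mem_Ioc, Finset.mem_Ico] at *
    grind

/-- An agent whose tie `t` lies strictly after `j` weakly prefers the items after `j` to the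
items up to `j`. -/
theorem value_insert_Ico_le_value_Ioc {m : ℕ} {u : Finset (Fin m) → ℝ} (hu : Monotonic u)
    {s t j r : Fin m} (hsj : s ≤ j) (hjt : j < t) (htr : t ≤ r)
    (h : u (Finset.Ico s t) ≤ u (insert t (Finset.Ioc t r))) :
    u (insert j (Finset.Ico s j)) ≤ u (Finset.Ioc j r) := by
  refine ((hu _ _ ?_).trans h).trans (hu _ _ ?_)
  all_goals
    intro x hx
    simp only [Finset.mem_insert, Finset.mem_Ioc, Finset.mem_Ico] at *
    grind

/-- Median Lumpy Ties Lemma. Three agents with monotonic valuations on a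
path; `P(v_s, v_r) = Icc s r` is a contiguous subsequence; `t a` is agent `a`'s lumpy tie
over `P(v_s, v_r)` (the least `k ∈ Icc s r` with
`u a (L(k) ∪ {k}) ≥ u a (R(k))` and `u a (R(k) ∪ {k}) ≥ u a (L(k))`, where
`L(k) = Ico s k` and `R(k) = Ioc k r`); `j` is the median of the three lumpy ties.
Let `S = {i, k}` with either (`i` a left agent and `k` a right agent) or (`i` a middle
agent), and let `Bi`, `Bk` be the bundles of the allocation `Lumpy(S, v_j, P(v_s,v_r))`:
in the first case `Bi = L(j)` and `Bk = R(j) ∪ {j}`; in the second case `k` gets a weakly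
preferred bundle among `L(j)` and `R(j)` and `i` gets the other bundle together with `j`.
Then this is an EF1 allocation of the items of `P(v_s,v_r)` to `{i, k}` and each of the
two agents weakly prefers their own bundle to both `L(j)` and `R(j)`. -/
theorem median_lumpy_ties {m : ℕ} (u : Fin 3 → Finset (Fin m) → ℝ)
    (hmono : ∀ a, Monotonic (u a)) (h0 : ∀ a, u a ∅ = 0)
    (s r : Fin m) (hsr : s ≤ r)
    (t : Fin 3 → Fin m)
    (ht : ∀ a : Fin 3, t a ∈ Finset.Icc s r ∧
      (u a (Finset.Ioc (t a) r) ≤ u a (insert (t a) (Finset.Ico s (t a))) ∧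
       u a (Finset.Ico s (t a)) ≤ u a (insert (t a) (Finset.Ioc (t a) r))) ∧
      ∀ k ∈ Finset.Icc s r,
        (u a (Finset.Ioc k r) ≤ u a (insert k (Finset.Ico s k)) ∧
         u a (Finset.Ico s k) ≤ u a (insert k (Finset.Ioc k r))) → t a ≤ k)
    (j : Fin m)
    (hmed : ∃ σ : Equiv.Perm (Fin 3),
        t (σ 0) ≤ t (σ 1) ∧ t (σ 1) ≤ t (σ 2) ∧ j = t (σ 1))
    (i k : Fin 3) (hik : i ≠ k)
    (Bi Bk : Finset (Fin m))
    (hcase :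
      (t i < j ∧ j < t k ∧
        Bi = Finset.Ico s j ∧ Bk = insert j (Finset.Ioc j r)) ∨
      (t i = j ∧
        ((Bk = Finset.Ico s j ∧ u k (Finset.Ioc j r) ≤ u k Bk ∧
            Bi = insert j (Finset.Ioc j r)) ∨
         (Bk = Finset.Ioc j r ∧ u k (Finset.Ico s j) ≤ u k Bk ∧
            Bi = insert j (Finset.Ico s j))))) :
    (Bi ∪ Bk = Finset.Icc s r ∧ Disjoint Bi Bk ∧ IsInterval Bi ∧ IsInterval Bk) ∧
    (Bk = ∅ ∨ ∃ v ∈ Bk, IsInterval (Bk \ {v}) ∧ u i (Bk \ {v}) ≤ u i Bi) ∧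
    (Bi = ∅ ∨ ∃ v ∈ Bi, IsInterval (Bi \ {v}) ∧ u k (Bi \ {v}) ≤ u k Bk) ∧
    (u i (Finset.Ico s j) ≤ u i Bi ∧ u i (Finset.Ioc j r) ≤ u i Bi) ∧
    (u k (Finset.Ico s j) ≤ u k Bk ∧ u k (Finset.Ioc j r) ≤ u k Bk) := by
  have hj : s ≤ j ∧ j ≤ r := by
    obtain ⟨σ, -, -, rfl⟩ := hmed
    exact Finset.mem_Icc.1 (ht (σ 1)).1
  have hR : insert j (Finset.Ioc j r) = Finset.Icc j r := Finset.Ioc_insert_left hj.2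
  have hL : insert j (Finset.Ico s j) = Finset.Icc s j := Finset.Ico_insert_right hj.1
  have hLR : Finset.Ico s j ∪ insert j (Finset.Ioc j r) = Finset.Icc s r ∧
      Disjoint (Finset.Ico s j) (insert j (Finset.Ioc j r)) := by
    rw [hR]
    refine ⟨?_, Finset.disjoint_left.2 fun x hx hx' => ?_⟩
    · ext x
      simp only [Finset.mem_union, Finset.mem_Icc, Finset.mem_Ico]
      grind
    · exact (Finset.mem_Ico.1 hx).2.not_ge (Finset.mem_Icc.1 hx').1
  have hRL : insert j (Finset.Ico s j) ∪ Finset.Ioc j r = Finset.Icc s r ∧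
      Disjoint (insert j (Finset.Ico s j)) (Finset.Ioc j r) := by
    rw [hL]
    refine ⟨?_, Finset.disjoint_left.2 fun x hx hx' => ?_⟩
    · ext x
      simp only [Finset.mem_union, Finset.mem_Icc, Finset.mem_Ioc]
      grind
    · exact (Finset.mem_Icc.1 hx).2.not_gt (Finset.mem_Ioc.1 hx').1
  have hRj : insert j (Finset.Ioc j r) \ {j} = Finset.Ioc j r := by
    rw [Finset.sdiff_singleton_eq_erase, Finset.erase_insert Finset.left_notMem_Ioc]
  have hLj : insert j (Finset.Ico s j) \ {j} = Finset.Ico s j := by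
    rw [Finset.sdiff_singleton_eq_erase, Finset.erase_insert Finset.right_notMem_Ico]
  have hRint : IsInterval (insert j (Finset.Ioc j r)) := hR ▸ isInterval_Icc j r
  have hLint : IsInterval (insert j (Finset.Ico s j)) := hL ▸ isInterval_Icc s j
  have hRle (a : Fin 3) : u a (Finset.Ioc j r) ≤ u a (insert j (Finset.Ioc j r)) :=
    hmono a _ _ (Finset.subset_insert _ _)
  have hLle (a : Fin 3) : u a (Finset.Ico s j) ≤ u a (insert j (Finset.Ico s j)) :=
    hmono a _ _ (Finset.subset_insert _ _)
  obtain ⟨hti, hi, -⟩ := ht i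
  obtain ⟨htk, hk, -⟩ := ht k
  rw [Finset.mem_Icc] at hti htk
  rcases hcase with ⟨hij, hjk, rfl, rfl⟩ | ⟨hij, ⟨rfl, hpref, rfl⟩ | ⟨rfl, hpref, rfl⟩⟩
  · have hi' := (hRle i).trans (value_insert_Ioc_le_value_Ico (hmono i) hti.1 hij hj.2 hi.1)
    have hk' := ((hLle k).trans
      (value_insert_Ico_le_value_Ioc (hmono k) hj.1 hjk htk.2 hk.2)).trans (hRle k)
    exact ⟨⟨hLR.1, hLR.2, isInterval_Ico s j, hRint⟩,
      Or.inr ⟨j, Finset.mem_insert_self _ _, by rw [hRj]; exact ⟨isInterval_Ioc j r, hi'⟩⟩,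
      Ico_eq_empty_or_exists_removable (hmono k) s j hk', ⟨le_rfl, hi'⟩, hk', hRle k⟩
  · rw [hij] at hi
    exact ⟨⟨by rw [Finset.union_comm, hLR.1], hLR.2.symm, hRint, isInterval_Ico s j⟩,
      Ico_eq_empty_or_exists_removable (hmono i) s j hi.2,
      Or.inr ⟨j, Finset.mem_insert_self _ _, by rw [hRj]; exact ⟨isInterval_Ioc j r, hpref⟩⟩,
      ⟨hi.2, hRle i⟩, le_rfl, hpref⟩
  · rw [hij] at hi
    exact ⟨⟨hRL.1, hRL.2, hLint, isInterval_Ioc j r⟩,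
      Ioc_eq_empty_or_exists_removable (hmono i) j r hi.1,
      Or.inr ⟨j, Finset.mem_insert_self _ _, by rw [hLj]; exact ⟨isInterval_Ico s j, hpref⟩⟩,
      ⟨hLle i, hi.1⟩, hpref, le_rfl⟩
end

section
/- Let G be a traceable graph (a graph containing a Hamiltonian path). For any three agents with monotonic valuations over the connected bundles of G, there exists a connected EF1 allocation. -/
variable {V : Type*}

namespace PathEF1

/-- The conditions on a family of interval valuations `f i a b`, the value of agent `i` for the
items with index in `[a, b)`. -/
structure IntervalVal (f : Fin 3 → ℕ → ℕ → ℝ) : Prop where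
  mono : ∀ i {a b a' b'}, a' ≤ a → b ≤ b' → f i a b ≤ f i a' b'
  empty : ∀ i {a b}, b ≤ a → f i a b = 0

/-- Agent `i` with value `v` does not envy `[a, b)` up to one outer good. -/
def NoEnvy (f : Fin 3 → ℕ → ℕ → ℝ) (i : Fin 3) (v : ℝ) (a b : ℕ) : Prop :=
  f i (a + 1) b ≤ v ∨ f i a (b - 1) ≤ v

/-- Giving `[0, x)`, `[x, y)`, `[y, m)` to `i`, `j`, `k` is an EF1 allocation. -/
structure IsEF1Cut (f : Fin 3 → ℕ → ℕ → ℝ) (m x y : ℕ) (i j k : Fin 3) : Prop where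
  le_xy : x ≤ y
  le_ym : y ≤ m
  ne_ij : i ≠ j
  ne_ik : i ≠ k
  ne_jk : j ≠ k
  left_mid : NoEnvy f i (f i 0 x) x y
  left_right : NoEnvy f i (f i 0 x) y m
  mid_left : NoEnvy f j (f j x y) 0 x
  mid_right : NoEnvy f j (f j x y) y m
  right_left : NoEnvy f k (f k y m) 0 x
  right_mid : NoEnvy f k (f k y m) x y

/-- Some cut of `[0, m)` is an EF1 allocation. -/
def HasEF1Cut (f : Fin 3 → ℕ → ℕ → ℝ) (m : ℕ) : Prop :=
  ∃ x y i j k, IsEF1Cut f m x y i j k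

/-- Agent `i` weakly prefers `[0, p)` to both `[a, r)` and `[r + 1, m)`. -/
def Shouts (f : Fin 3 → ℕ → ℕ → ℝ) (m p a r : ℕ) (i : Fin 3) : Prop :=
  f i a r ≤ f i 0 p ∧ f i (r + 1) m ≤ f i 0 p

/-- The item `r` is a median of the points at which the agents would halve `[q, m)`. -/
structure IsMedian (f : Fin 3 → ℕ → ℕ → ℝ) (m q r : ℕ) : Prop where
  le : q ≤ r
  lt : r < m
  two_left : ∃ c, ∀ i, i ≠ c → f i (r + 1) m ≤ f i q (r + 1)
  two_right : ∃ c, ∀ i, i ≠ c → f i q r ≤ f i r m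

theorem exists_others (s : Fin 3) :
    ∃ j k : Fin 3, s ≠ j ∧ s ≠ k ∧ j ≠ k ∧ ∀ z, z = s ∨ z = j ∨ z = k := by
  revert s; decide

/-- If each agent satisfies `X` or `Y` and each of `X`, `Y` fails for at most one agent, then the
two agents other than `s` can be assigned to `X` and `Y`. -/
theorem exists_assignment {X Y : Fin 3 → Prop} (s : Fin 3) (hXY : ∀ i, i ≠ s → X i ∨ Y i)
    (hX : ∃ c, ∀ i, i ≠ c → X i) (hY : ∃ c, ∀ i, i ≠ c → Y i) :
    ∃ j k, s ≠ j ∧ s ≠ k ∧ j ≠ k ∧ X j ∧ Y k := by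
  obtain ⟨j, k, hj, hk, hjk, -⟩ := exists_others s
  obtain ⟨c, hX⟩ := hX
  obtain ⟨d, hY⟩ := hY
  have h1 : X j ∨ X k := by
    by_cases h : j = c
    · exact .inr (hX k (h ▸ hjk.symm))
    · exact .inl (hX j h)
  have h2 : Y j ∨ Y k := by
    by_cases h : j = d
    · exact .inr (hY k (h ▸ hjk.symm))
    · exact .inl (hY j h)
  have h3 := hXY j hj.symm
  have h4 := hXY k hk.symm
  by_cases hA : X j ∧ Y k
  · exact ⟨j, k, hj, hk, hjk, hA⟩
  · exact ⟨k, j, hk, hj, hjk.symm, by tauto⟩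

variable {f : Fin 3 → ℕ → ℕ → ℝ} {m : ℕ}

/-- If `s` shouts at a median and the other agents prefer one of the other two pieces to `[0, q)`
without its last item, then `[0, q)` can be given to `s`. -/
theorem IsMedian.hasEF1Cut (hf : IntervalVal f) {q r : ℕ} (h : IsMedian f m q r) (s : Fin 3)
    (hs : Shouts f m q q r s)
    (ho : ∀ i, i ≠ s → f i 0 (q - 1) ≤ f i q r ∨ f i 0 (q - 1) ≤ f i (r + 1) m) :
    HasEF1Cut f m := by
  have hqr := h.le
  have hrm := h.lt
  obtain ⟨j, k, hsj, hsk, hjk, hj, hk⟩ := exists_assignment s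
    (X := fun i => f i (r + 1) m ≤ f i q (r + 1)) (Y := fun i => f i q r ≤ f i r m)
    (fun i _ => by
      by_contra! hc
      have h1 := hf.mono i (le_refl q) (Nat.le_succ r)
      have h2 := hf.mono i (Nat.le_succ r) (le_refl m)
      simp only [Nat.succ_eq_add_one] at h1 h2
      linarith) h.two_left h.two_right
  have hL (i) : f i q r ≤ f i q (r + 1) := hf.mono i le_rfl (by omega)
  have hR (i) : f i (r + 1) m ≤ f i r m := hf.mono i (by omega) le_rfl
  have hoj := ho j hsj.symm
  have hok := ho k hsk.symm
  have hLj := hL j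
  have hLk := hL k
  have hRj := hR j
  have hRk := hR k
  by_cases c1 : f j (r + 1) m ≤ f j q r
  · refine ⟨q, r, s, j, k, hqr, hrm.le, hsj, hsk, hjk, .inr ?_, .inl hs.2, .inr ?_, .inl c1,
      .inr ?_, .inr ?_⟩
    · exact (hf.mono s le_rfl (by omega)).trans hs.1
    · rcases hoj with h | h <;> linarith
    · rcases hok with h | h <;> linarith
    · exact (hf.mono k le_rfl (by omega)).trans hk
  by_cases c2 : f k q r ≤ f k (r + 1) m
  · refine ⟨q, r + 1, s, j, k, by omega, hrm, hsj, hsk, hjk, .inr hs.1, .inl ?_, .inr ?_, .inl ?_,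
      .inr ?_, .inr c2⟩
    · exact (hf.mono s (by omega) le_rfl).trans hs.2
    · rcases hoj with h | h <;> linarith
    · exact (hf.mono j (by omega) le_rfl).trans hj
    · rcases hok with h | h <;> linarith
  · refine ⟨q, r, s, k, j, hqr, hrm.le, hsk, hsj, hjk.symm, .inr ?_, .inl hs.2, .inr ?_, .inl ?_,
      .inr ?_, .inr ?_⟩
    · exact (hf.mono s le_rfl (by omega)).trans hs.1
    · rcases hok with h | h <;> linarith
    · linarith
    · rcases hoj with h | h <;> linarith
    · exact (hf.mono j (le_refl q) (Nat.sub_le r 1)).trans (by linarith)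

/-- The cut `[0, p)`, `[p, y)`, `[y, m)` when the owner of `[0, p)` shouts with `p` and `y`
removed from the other pieces. -/
theorem hasEF1Cut_of_shouts (hf : IntervalVal f) {p y : ℕ} (hpy : p ≤ y) (hym : y ≤ m)
    {i j k : Fin 3} (hij : i ≠ j) (hik : i ≠ k) (hjk : j ≠ k) (hi : Shouts f m p (p + 1) y i)
    (hj : f j (y + 1) m ≤ f j p y) (hj' : f j 0 p ≤ f j p y)
    (hk : f k (p + 1) y ≤ f k y m ∨ f k p (y - 1) ≤ f k y m) (hk' : f k 0 p ≤ f k y m) :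
    HasEF1Cut f m :=
  ⟨p, y, i, j, k, hpy, hym, hij, hik, hjk, .inl hi.1, .inl hi.2,
    .inl ((hf.mono j (Nat.zero_le _) le_rfl).trans hj'), .inl hj,
    .inl ((hf.mono k (Nat.zero_le _) le_rfl).trans hk'), hk⟩

/-- If at most one agent halves `[q, m)` strictly before `r`, then some median is at least `r`. -/
theorem exists_isMedian_ge (hf : IntervalVal f) {q r : ℕ} (hq : q < m) (hr : r < m)
    (h : q ≤ r → ∃ c, ∀ i, i ≠ c → f i q r ≤ f i r m) : ∃ r', r ≤ r' ∧ IsMedian f m q r' := by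
  classical
  have hex : ∃ x, r ≤ x ∧ q ≤ x ∧ x < m ∧
      ∃ c : Fin 3, ∀ i, i ≠ c → f i (x + 1) m ≤ f i q (x + 1) := by
    refine ⟨m - 1, by omega, by omega, by omega, 0, fun i _ => ?_⟩
    rw [show m - 1 + 1 = m by omega, hf.empty i (le_refl m), ← hf.empty i (le_refl m)]
    exact hf.mono i hq.le le_rfl
  obtain ⟨x, ⟨hrx, hqx, hxm, hx⟩, hmin⟩ :=
    (⟨Nat.find hex, Nat.find_spec hex, fun _ => Nat.find_min hex⟩ :
      ∃ x, (r ≤ x ∧ q ≤ x ∧ x < m ∧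
      ∃ c : Fin 3, ∀ i, i ≠ c → f i (x + 1) m ≤ f i q (x + 1)) ∧ ∀ y, y < x →
      ¬ (r ≤ y ∧ q ≤ y ∧ y < m ∧
      ∃ c : Fin 3, ∀ i, i ≠ c → f i (y + 1) m ≤ f i q (y + 1)))
  refine ⟨x, hrx, hqx, hxm, hx, ?_⟩
  rcases hrx.eq_or_lt with rfl | hrx
  · exact h hqx
  rcases hqx.eq_or_lt with rfl | hqx
  · refine ⟨0, fun i _ => ?_⟩
    rw [hf.empty i le_rfl, ← hf.empty i (le_refl m)]
    exact hf.mono i hq.le le_rfl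
  have h1 := hmin (x - 1) (by omega)
  rw [show x - 1 + 1 = x by omega] at h1
  have h2 : ¬ ∃ c : Fin 3, ∀ i, i ≠ c → f i x m ≤ f i q x :=
    fun hc => h1 ⟨by omega, by omega, by omega, hc⟩
  by_contra h3
  push Not at h2 h3
  obtain ⟨a, ha, ha'⟩ := h3 0
  obtain ⟨b, hb, hb'⟩ := h3 a
  obtain ⟨j, k, hj, hk, hjk, hall⟩ := exists_others a
  obtain ⟨c, hc, hc'⟩ := h2 (if b = j then k else j)
  have hca : c ≠ a := by rintro rfl; linarith
  have hcb : c ≠ b := by rintro rfl; linarith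
  have hc1 := hall c
  have hb1 := hall b
  split_ifs at hc with hbj <;> grind

/-- Advancing the right cut from `y - 1` to `y` makes `i` shout while the other agents did not
shout before. -/
theorem hasEF1Cut_of_advance (hf : IntervalVal f) {p r y r' : ℕ} (hr : IsMedian f m p r)
    (hr' : IsMedian f m (p + 1) r') (hry : r < y) (hyr : y ≤ r') {i : Fin 3}
    (hi : Shouts f m p (p + 1) y i) (ho : ∀ z, z ≠ i → ¬ Shouts f m p (p + 1) (y - 1) z) :
    HasEF1Cut f m := by
  have := hr.le
  have := hr'.lt
  have hns (z) (hz : z ≠ i) : f z 0 p < f z (p + 1) (y - 1) ∨ f z 0 p < f z y m := by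
    have := ho z hz
    rw [Shouts, show y - 1 + 1 = y by omega] at this
    by_contra! hc
    exact this hc
  obtain ⟨j, k, hij, hik, hjk, hj, hk⟩ := exists_assignment i
    (X := fun z => f z y m ≤ f z p y) (Y := fun z => f z (p + 1) y ≤ f z y m)
    (fun z _ => by
      by_contra! hc
      linarith [hf.mono z (Nat.le_succ p) (le_refl y)])
    (by
      obtain ⟨c, hc⟩ := hr.two_left
      exact ⟨c, fun z hz => (hf.mono z (by omega) le_rfl).trans
        ((hc z hz).trans (hf.mono z le_rfl (by omega)))⟩)
    (by
      obtain ⟨c, hc⟩ := hr'.two_right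
      exact ⟨c, fun z hz => (hf.mono z le_rfl hyr).trans
        ((hc z hz).trans (hf.mono z hyr le_rfl))⟩)
  refine hasEF1Cut_of_shouts hf (by omega) (by omega) hij hik hjk hi
    ((hf.mono j (by omega) le_rfl).trans hj) ?_ (.inl hk) ?_
  · have := hf.mono j (show p ≤ p + 1 by omega) (show y - 1 ≤ y by omega)
    rcases hns j hij.symm with h | h <;> linarith
  · have := hf.mono k (le_refl (p + 1)) (show y - 1 ≤ y by omega)
    rcases hns k hik.symm with h | h <;> linarith

/-- If only the removal of `p` from the middle piece makes `s` shout, then either there is an EF1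
cut, or all other agents strictly prefer the right piece to `[0, p)`. -/
theorem hasEF1Cut_or_of_delete (hf : IntervalVal f) {p r : ℕ} (hr : IsMedian f m p r)
    (hA : ∀ i, ¬ Shouts f m p p r i) {s : Fin 3} (hs : Shouts f m p (p + 1) r s) :
    HasEF1Cut f m ∨ ∀ i, i ≠ s → f i 0 p < f i (r + 1) m := by
  have hns (z) : f z 0 p < f z p r ∨ f z 0 p < f z (r + 1) m := by
    by_contra! hc
    exact hA z hc
  have hR (i) : f i (r + 1) m ≤ f i r m := hf.mono i (by omega) le_rfl
  have hpr := hr.le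
  have hrm := hr.lt
  obtain ⟨j, k, hsj, hsk, hjk, hall⟩ := exists_others s
  -- an agent preferring `[p, r)` to `[r + 1, m)` takes it, if the other one accepts `[r, m)`
  have key (a b : Fin 3) (hsa : s ≠ a) (hsb : s ≠ b) (hab : a ≠ b)
      (ha : f a (r + 1) m ≤ f a p r) (hb : f b p r ≤ f b r m) : HasEF1Cut f m := by
    refine hasEF1Cut_of_shouts hf hpr hrm.le hsa hsb hab hs ha ?_ (.inl ?_) ?_
    · rcases hns a with h | h <;> linarith
    · exact (hf.mono b (by omega) le_rfl).trans hb
    · have := hR b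
      rcases hns b with h | h <;> linarith
  by_cases hcut : HasEF1Cut f m
  · exact .inl hcut
  refine .inr fun i hi => ?_
  by_contra! hc
  have hir : f i (r + 1) m < f i p r := by
    rcases hns i with h | h <;> linarith
  obtain ⟨l, hsl, hil⟩ : ∃ l, s ≠ l ∧ i ≠ l := by
    rcases hall i with h | rfl | rfl
    · exact absurd h hi
    · exact ⟨k, hsk, hjk⟩
    · exact ⟨j, hsj, hjk.symm⟩
  have hl : f l r m < f l p r := by
    by_contra! hl
    exact hcut (key i l hi.symm hsl hil hir.le hl)
  have hi' : f i r m < f i p r := by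
    by_contra! hi'
    exact hcut (key l i hsl hi.symm hil.symm ((hR l).trans hl.le) hi')
  obtain ⟨c, hc⟩ := hr.two_right
  by_cases h : i = c
  · exact absurd (hc l (h ▸ hil.symm)) (not_le.2 hl)
  · exact absurd (hc i h) (not_le.2 hi')

/-- If nobody shouts before `p` is removed from the middle piece, then either there is an EF1 cut,
or nobody shouts after moving the right cut to the next median. -/
theorem hasEF1Cut_or_of_right_moves (hf : IntervalVal f) {p r r' : ℕ} (hr : IsMedian f m p r)
    (hr' : IsMedian f m (p + 1) r') (hrr : r ≤ r') (hA : ∀ i, ¬ Shouts f m p p r i) :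
    HasEF1Cut f m ∨ ∀ i, ¬ Shouts f m p (p + 1) r' i := by
  by_cases hcut : HasEF1Cut f m
  · exact .inl hcut
  refine .inr ?_
  have hpr := hr.le
  have hrm' := hr'.lt
  -- a single shouter at `r'` would take `[0, p + 1)`
  have single (s) (hs : Shouts f m p (p + 1) r' s)
      (ho : ∀ i, i ≠ s → ¬ Shouts f m p (p + 1) r' i) : False := by
    refine hcut (hr'.hasEF1Cut hf s ?_ fun i hi => ?_)
    · have := hf.mono s (le_refl 0) (Nat.le_succ p)
      exact ⟨hs.1.trans this, hs.2.trans this⟩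
    · have := ho i hi
      rw [Nat.add_sub_cancel]
      by_contra! hc
      exact this ⟨hc.1.le, hc.2.le⟩
  have hdel (s) (hs : Shouts f m p (p + 1) r s) : ∀ i, i ≠ s → f i 0 p < f i (r + 1) m :=
    (hasEF1Cut_or_of_delete hf hr hA hs).resolve_left hcut
  rcases hrr.eq_or_lt with rfl | hlt
  · intro s hs
    exact single s hs fun i hi h => absurd h.2 (not_le.2 (hdel s hs i hi))
  have hsucc : ∀ i, ¬ Shouts f m p (p + 1) (r + 1) i := by
    intro j hj
    by_cases hex : ∃ s, s ≠ j ∧ Shouts f m p (p + 1) r s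
    · obtain ⟨s, hsj, hs⟩ := hex
      have hd := hdel s hs
      by_cases hs1 : Shouts f m p (p + 1) (r + 1) s
      · exact hcut (hasEF1Cut_of_advance hf hr hr' (Nat.lt_succ_self r) hlt hs1
          fun z hz h => absurd h.2 (not_le.2 (hd z hz)))
      · have hs2 : f s 0 p < f s (p + 1) (r + 1) := by
          by_contra! hc
          exact hs1 ⟨hc, (hf.mono s (by omega) le_rfl).trans hs.2⟩
        obtain ⟨k, hjk, hsk⟩ : ∃ k, j ≠ k ∧ s ≠ k := by
          revert hsj; clear * -; revert s j; decide
        have hMs := hf.mono s (Nat.le_succ p) (le_refl (r + 1))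
        have hsr := hs.2
        refine hcut (hasEF1Cut_of_shouts hf (by omega) (by omega) hsj.symm hjk hsk hj
          ?_ (by linarith) (.inl ?_) (hd k hsk.symm).le)
        · exact (hf.mono s (by omega) le_rfl).trans (show f s (r + 1) m ≤ _ by linarith)
        · obtain ⟨c, hc⟩ := hr'.two_right
          have h1 := hf.mono s (le_refl (p + 1)) hlt
          have h2 := hf.mono s hlt (le_refl m)
          simp only [Nat.succ_eq_add_one] at h1 h2
          have hsc : s = c := by
            by_contra hne
            linarith [hc s hne]
          exact (hf.mono k le_rfl hlt).trans ((hc k (hsc ▸ hsk.symm)).trans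
            (hf.mono k hlt le_rfl))
    · push Not at hex
      exact hcut (hasEF1Cut_of_advance hf hr hr' (Nat.lt_succ_self r) hlt hj hex)
  have hall : ∀ y, r + 1 ≤ y → y ≤ r' → ∀ i, ¬ Shouts f m p (p + 1) y i := by
    intro y hy
    induction y, hy using Nat.le_induction with
    | base => exact fun _ => hsucc
    | succ y hy ih =>
      intro hyr i hi
      exact hcut (hasEF1Cut_of_advance hf hr hr' (by omega) hyr hi fun z _ => ih (by omega) z)
  exact hall r' hlt le_rfl

/-- Three agents with monotone interval valuations always have an EF1 cut. -/
theorem hasEF1Cut (hf : IntervalVal f) (hm : 0 < m) : HasEF1Cut f m := by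
  by_contra hcut
  have hnn (i a b) : 0 ≤ f i a b := by
    rw [← hf.empty i (show min a b ≤ max a b by omega)]
    exact hf.mono i (by omega) (by omega)
  have main : ∀ p, p < m → ∃ r, IsMedian f m p r ∧ ∀ i, ¬ Shouts f m p p r i := by
    intro p
    induction p with
    | zero =>
      intro _
      have hempty (i) : f i 0 0 = 0 := hf.empty i le_rfl
      obtain ⟨r, -, hr⟩ := exists_isMedian_ge hf hm hm fun _ =>
        ⟨0, fun i _ => (hempty i).trans_le (hnn _ _ _)⟩
      refine ⟨r, hr, fun s hs => hcut (hr.hasEF1Cut hf s hs fun i _ => .inl ?_)⟩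
      exact (hempty i).trans_le (hnn _ _ _)
    | succ p ih =>
      intro hp
      obtain ⟨r, hr, hA⟩ := ih (by omega)
      obtain ⟨r', hrr, hr'⟩ := exists_isMedian_ge hf hp hr.lt fun _ => by
        obtain ⟨c, hc⟩ := hr.two_right
        exact ⟨c, fun i hi => (hf.mono i (by omega) le_rfl).trans (hc i hi)⟩
      have hB := (hasEF1Cut_or_of_right_moves hf hr hr' hrr hA).resolve_left hcut
      refine ⟨r', hr', fun s hs => hcut (hr'.hasEF1Cut hf s hs fun i _ => ?_)⟩
      rw [Nat.add_sub_cancel]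
      by_contra! hc
      exact hB i ⟨hc.1.le, hc.2.le⟩
  obtain ⟨r, hr, hA⟩ := main (m - 1) (by omega)
  have h1 := hr.le
  have h2 := hr.lt
  refine hA 0 ⟨?_, ?_⟩ <;> rw [hf.empty 0 (by omega)] <;> exact hnn _ _ _

/-- The items with index in `[a, b)` in the ordering `e`. -/
def bundle {V : Type*} [DecidableEq V] {n : ℕ} (e : Fin n ≃ V) (a b : ℕ) : Finset V :=
  (Finset.univ.filter fun x : Fin n => a ≤ x ∧ x < b).image e

section Bundle

variable {V : Type*} [DecidableEq V] {n : ℕ} (e : Fin n ≃ V)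

theorem mem_bundle {a b : ℕ} {v : V} :
    v ∈ bundle e a b ↔ a ≤ (e.symm v : ℕ) ∧ (e.symm v : ℕ) < b := by
  simp only [bundle, Finset.mem_image, Finset.mem_filter, Finset.mem_univ, true_and]
  refine ⟨?_, fun h => ⟨e.symm v, h, e.apply_symm_apply v⟩⟩
  rintro ⟨x, hx, rfl⟩
  simpa using hx

theorem bundle_subset {a b a' b' : ℕ} (ha : a' ≤ a) (hb : b ≤ b') :
    bundle e a b ⊆ bundle e a' b' := by
  intro v hv
  rw [mem_bundle] at hv ⊢
  omega

theorem bundle_eq_empty {a b : ℕ} (h : b ≤ a) : bundle e a b = ∅ := by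
  refine Finset.eq_empty_of_forall_notMem fun v hv => ?_
  rw [mem_bundle] at hv
  omega

theorem bundle_sdiff_left {a b : ℕ} (ha : a < n) :
    bundle e a b \ {e ⟨a, ha⟩} = bundle e (a + 1) b := by
  ext v
  simp only [Finset.mem_sdiff, mem_bundle, Finset.mem_singleton, ← Equiv.symm_apply_eq,
    Fin.ext_iff]
  omega

theorem bundle_sdiff_right {a b : ℕ} (hb : b - 1 < n) :
    bundle e a b \ {e ⟨b - 1, hb⟩} = bundle e a (b - 1) := by
  ext v
  simp only [Finset.mem_sdiff, mem_bundle, Finset.mem_singleton, ← Equiv.symm_apply_eq,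
    Fin.ext_iff]
  omega

theorem gConnBundle_bundle {G : SimpleGraph V}
    (he : ∀ j k : Fin n, (j : ℕ) + 1 = k → G.Adj (e j) (e k)) (a b : ℕ) :
    GConnBundle G (bundle e a b) := by
  have key : ∀ d : ℕ, ∀ v w : (bundle e a b : Set V),
      (e.symm v : ℕ) + d = e.symm w → (G.induce (bundle e a b : Set V)).Reachable v w := by
    intro d
    induction d with
    | zero =>
      intro v w h
      have : v = w := Subtype.ext (e.symm.injective (Fin.ext h))
      exact this ▸ .refl _
    | succ d ih =>
      intro v w h
      have hv := (mem_bundle e).1 (Finset.mem_coe.1 v.2)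
      have hw := (mem_bundle e).1 (Finset.mem_coe.1 w.2)
      have hlt := (e.symm w).2
      let x : Fin n := ⟨e.symm v + d, by omega⟩
      have hx : e x ∈ bundle e a b := by
        rw [mem_bundle, e.symm_apply_apply]
        change a ≤ (e.symm v : ℕ) + d ∧ (e.symm v : ℕ) + d < b
        omega
      refine (ih v ⟨e x, hx⟩ (by simp [x])).trans (SimpleGraph.Adj.reachable ?_)
      have := he x (e.symm w) (by simp only [x]; omega)
      rw [e.apply_symm_apply] at this
      exact this
  intro v w
  rcases le_total (e.symm v : ℕ) (e.symm w) with h | h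
  · exact key _ v w (Nat.add_sub_cancel' h)
  · exact (key _ w v (Nat.add_sub_cancel' h)).symm

theorem intervalVal_bundle {u : Fin 3 → Finset V → ℝ} (hmono : ∀ i, GMonotonic (u i))
    (h0 : ∀ i, u i ∅ = 0) : IntervalVal fun i a b => u i (bundle e a b) where
  mono i _ _ _ _ ha hb := hmono i _ _ (bundle_subset e ha hb)
  empty i a b h := by rw [bundle_eq_empty e h, h0]

theorem ef1_of_noEnvy {G : SimpleGraph V}
    (he : ∀ j k : Fin n, (j : ℕ) + 1 = k → G.Adj (e j) (e k)) {u : Fin 3 → Finset V → ℝ}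
    {i : Fin 3} {v : ℝ} {a b : ℕ} (hb : b ≤ n)
    (h : NoEnvy (fun i a b => u i (bundle e a b)) i v a b) :
    bundle e a b = ∅ ∨ ∃ x ∈ bundle e a b,
      GConnBundle G (bundle e a b \ {x}) ∧ u i (bundle e a b \ {x}) ≤ v := by
  rcases le_or_gt b a with hba | hab
  · exact .inl (bundle_eq_empty e hba)
  refine .inr ?_
  rcases h with h | h
  · refine ⟨e ⟨a, by omega⟩, ?_, ?_⟩
    · rw [mem_bundle, e.symm_apply_apply]
      exact ⟨le_rfl, hab⟩
    · rw [bundle_sdiff_left]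
      exact ⟨gConnBundle_bundle e he _ _, h⟩
  · refine ⟨e ⟨b - 1, by omega⟩, ?_, ?_⟩
    · rw [mem_bundle, e.symm_apply_apply]
      change a ≤ b - 1 ∧ b - 1 < b
      omega
    · rw [bundle_sdiff_right]
      exact ⟨gConnBundle_bundle e he _ _, h⟩

end Bundle

end PathEF1

/-- if `G` is traceable (it has a Hamiltonian path, given by an ordering of
the vertices in which consecutive vertices are adjacent), then for any three agents with
monotonic valuations over the connected bundles of `G` a connected EF1 allocation exists. -/
theorem traceable_EF1_three_agents {V : Type*} [Fintype V] [DecidableEq V]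
    (G : SimpleGraph V)
    (htr : ∃ e : Fin (Fintype.card V) ≃ V,
        ∀ j k : Fin (Fintype.card V), (j : ℕ) + 1 = (k : ℕ) → G.Adj (e j) (e k))
    (u : Fin 3 → Finset V → ℝ)
    (hmono : ∀ i, GMonotonic (u i)) (h0 : ∀ i, u i ∅ = 0) :
    ∃ A : Fin 3 → Finset V, GConnAlloc G A ∧ GEF1 G u A := by
  obtain ⟨e, he⟩ := htr
  rcases Nat.eq_zero_or_pos (Fintype.card V) with hc | hc
  · have := Fintype.card_eq_zero_iff.1 hc
    exact ⟨fun _ => ∅, ⟨fun _ v => this.elim v.1, fun _ _ _ => disjoint_bot_left,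
      fun v => this.elim v⟩, fun _ _ => .inl rfl⟩
  obtain ⟨x, y, i, j, k, h⟩ := PathEF1.hasEF1Cut (PathEF1.intervalVal_bundle e hmono h0) hc
  have hxy := h.le_xy
  have hyc := h.le_ym
  have hji := h.ne_ij.symm
  have hki := h.ne_ik.symm
  have hkj := h.ne_jk.symm
  have hall : ∀ z, z = i ∨ z = j ∨ z = k := by
    have := h.ne_ij
    have := h.ne_ik
    have := h.ne_jk
    omega
  have conn := PathEF1.gConnBundle_bundle e he
  let A : Fin 3 → Finset V := fun z =>
    if z = i then PathEF1.bundle e 0 x else if z = j then PathEF1.bundle e x y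
    else PathEF1.bundle e y (Fintype.card V)
  have hAi : A i = PathEF1.bundle e 0 x := by simp [A]
  have hAj : A j = PathEF1.bundle e x y := by simp [A, hji]
  have hAk : A k = PathEF1.bundle e y (Fintype.card V) := by simp [A, hki, hkj]
  have self (z) : A z = ∅ ∨
      ∃ v ∈ A z, GConnBundle G (A z \ {v}) ∧ u z (A z \ {v}) ≤ u z (A z) := by
    obtain ⟨a, b, hb, hA⟩ : ∃ a b, b ≤ Fintype.card V ∧ A z = PathEF1.bundle e a b := by
      rcases hall z with rfl | rfl | rfl
      exacts [⟨_, _, hxy.trans hyc, hAi⟩, ⟨_, _, hyc, hAj⟩, ⟨_, _, le_rfl, hAk⟩]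
    rw [hA]
    exact PathEF1.ef1_of_noEnvy e he hb
      (.inl (hmono z _ _ (PathEF1.bundle_subset e (Nat.le_succ a) le_rfl)))
  refine ⟨A, ⟨fun z => ?_, fun z w hzw => ?_, fun v => ?_⟩, fun z w => ?_⟩
  · rcases hall z with rfl | rfl | rfl
    exacts [hAi ▸ conn _ _, hAj ▸ conn _ _, hAk ▸ conn _ _]
  · rw [Finset.disjoint_left]
    intro v hv hw
    rcases hall z with rfl | rfl | rfl <;> rcases hall w with rfl | rfl | rfl <;>
      first
        | exact hzw rfl
        | (simp only [hAi, hAj, hAk, PathEF1.mem_bundle] at hv hw; omega)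
  · have hv := (e.symm v).2
    rcases lt_or_ge (e.symm v : ℕ) x with h1 | h1
    · exact ⟨i, by rw [hAi, PathEF1.mem_bundle]; omega⟩
    rcases lt_or_ge (e.symm v : ℕ) y with h2 | h2
    · exact ⟨j, by rw [hAj, PathEF1.mem_bundle]; omega⟩
    · exact ⟨k, by rw [hAk, PathEF1.mem_bundle]; omega⟩
  · by_cases hzw : z = w
    · exact hzw ▸ self z
    have hxc := hxy.trans hyc
    rcases hall z with rfl | rfl | rfl <;> rcases hall w with rfl | rfl | rfl
    · exact absurd rfl hzw
    · rw [hAi, hAj]; exact PathEF1.ef1_of_noEnvy e he hyc h.left_mid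
    · rw [hAi, hAk]; exact PathEF1.ef1_of_noEnvy e he le_rfl h.left_right
    · rw [hAj, hAi]; exact PathEF1.ef1_of_noEnvy e he hxc h.mid_left
    · exact absurd rfl hzw
    · rw [hAj, hAk]; exact PathEF1.ef1_of_noEnvy e he le_rfl h.mid_right
    · rw [hAk, hAi]; exact PathEF1.ef1_of_noEnvy e he hxc h.right_left
    · rw [hAk, hAj]; exact PathEF1.ef1_of_noEnvy e he hyc h.right_mid
    · exact absurd rfl hzw
end

section
/- On a path of m items, for any number n of agents with monotonic valuations, there exists a connected EF2 allocation, i.e., a partition of the path into n intervals assigned to the agents such that for every pair of agents i, j, either agent j's bundle has at most one item, or there are two items whose removal leaves agent j's bundle connected and whose removal eliminates agent i's envy. -/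
/-- A connected allocation on a path: every bundle is an interval, bundles are pairwise
disjoint, and every item belongs to some bundle. -/
def IsConnAlloc {n m : ℕ} (A : Fin n → Finset (Fin m)) : Prop :=
  (∀ i, IsInterval (A i)) ∧ (∀ i j, i ≠ j → Disjoint (A i) (A j)) ∧
    ∀ v : Fin m, ∃ i, v ∈ A i

/-- EF1 (envy-freeness up to one outer good) on a path. -/
def EF1 {n m : ℕ} (u : Fin n → Finset (Fin m) → ℝ) (A : Fin n → Finset (Fin m)) : Prop :=
  ∀ i j : Fin n, A j = ∅ ∨
    ∃ v ∈ A j, IsInterval (A j \ {v}) ∧ u i (A j \ {v}) ≤ u i (A i)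

/-- EF2 (envy-freeness up to two outer goods) on a path. -/
def EF2 {n m : ℕ} (u : Fin n → Finset (Fin m) → ℝ) (A : Fin n → Finset (Fin m)) : Prop :=
  ∀ i j : Fin n, (A j).card ≤ 1 ∨
    ∃ v ∈ A j, ∃ w ∈ A j, v ≠ w ∧ IsInterval (A j \ {v, w}) ∧
      u i (A j \ {v, w}) ≤ u i (A i)

/-- The vertex of index `k` of the simplex of Kuhn's triangulation that lies in the unit cube with
lowest corner `y` and is given by the ordering `σ` of the coordinates. -/
def kuhnVertex {d : ℕ} (y : Fin d → ℕ) (σ : Equiv.Perm (Fin d)) (k : ℕ) : Fin d → ℕ :=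
  fun i => y i + if k ≤ (σ i : ℕ) then 1 else 0

/-- The labels of the vertices other than `k` include every nonzero label. -/
def IsDoor {d : ℕ} (a : Fin (d + 2) → Fin (d + 2)) (k : Fin (d + 2)) : Prop :=
  ∀ c, c ≠ 0 → ∃ l, l ≠ k ∧ a l = c

theorem IsDoor.injOn {d : ℕ} {a : Fin (d + 2) → Fin (d + 2)} {k : Fin (d + 2)}
    (h : IsDoor a k) {l l' : Fin (d + 2)} (hl : l ≠ k) (hl' : l' ≠ k) (e : a l = a l') :
    l = l' := by
  have hsub : ({0}ᶜ : Finset (Fin (d + 2))) ⊆ ({k}ᶜ : Finset (Fin (d + 2))).image a := by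
    intro c hc
    obtain ⟨l, hl, rfl⟩ := h c (by simpa using hc)
    exact Finset.mem_image_of_mem _ (by simpa using hl)
  have hcard : (({k}ᶜ : Finset (Fin (d + 2))).image a).card =
      ({k}ᶜ : Finset (Fin (d + 2))).card := by
    refine le_antisymm Finset.card_image_le ?_
    refine le_trans (le_of_eq ?_) (Finset.card_le_card hsub)
    simp [Finset.card_compl]
  exact Finset.card_image_iff.1 hcard (by simpa using hl) (by simpa using hl') e

open Classical in
theorem sum_isDoor {d : ℕ} (a : Fin (d + 2) → Fin (d + 2)) :
    (if Function.Surjective a then (1 : ZMod 2) else 0) =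
      ∑ k, if IsDoor a k then (1 : ZMod 2) else 0 := by
  by_cases hs : Function.Surjective a
  · obtain ⟨k, hk⟩ := hs 0
    have hi : Function.Injective a := Finite.injective_iff_surjective.2 hs
    rw [if_pos hs, Finset.sum_eq_single k, if_pos]
    · intro c hc
      obtain ⟨l, rfl⟩ := hs c
      exact ⟨l, fun e => hc (e ▸ hk), rfl⟩
    · intro b _ hb
      refine if_neg fun h => ?_
      obtain ⟨l, hl, e⟩ := h (a b) (fun e => hb (hi (e.trans hk.symm)))
      exact hl (hi e)
    · simp
  · rw [if_neg hs]
    by_cases hd : ∃ k, IsDoor a k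
    · obtain ⟨k, hk⟩ := hd
      have hak : a k ≠ 0 := by
        intro h
        refine hs fun c => ?_
        by_cases hc : c = 0
        · exact ⟨k, h.trans hc.symm⟩
        · obtain ⟨l, -, e⟩ := hk c hc
          exact ⟨l, e⟩
      obtain ⟨l, hl, e⟩ := hk _ hak
      have hdl : IsDoor a l := by
        intro c hc
        obtain ⟨p, hp, rfl⟩ := hk c hc
        by_cases hpl : p = l
        · exact ⟨k, hl.symm, by rw [hpl, e]⟩
        · exact ⟨p, hpl, rfl⟩
      rw [← Finset.sum_subset (Finset.subset_univ {k, l}), Finset.sum_pair hl.symm, if_pos hk,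
        if_pos hdl]
      · decide
      · intro p _ hp
        simp only [Finset.mem_insert, Finset.mem_singleton, not_or] at hp
        refine if_neg fun h => ?_
        exact hl (h.injOn (Ne.symm hp.2) (Ne.symm hp.1) e)
    · push Not at hd
      simp [hd]

theorem kuhnVertex_swap {d : ℕ} (y : Fin (d + 1) → ℕ) (σ : Equiv.Perm (Fin (d + 1))) (k : Fin d)
    (l : ℕ) (hl : l ≠ k + 1) :
    kuhnVertex y (σ.trans (Equiv.swap k.castSucc k.succ)) l = kuhnVertex y σ l := by
  funext i
  simp only [kuhnVertex, Equiv.trans_apply]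
  congr 1
  have : l ≤ (Equiv.swap k.castSucc k.succ (σ i) : ℕ) ↔ l ≤ (σ i : ℕ) := by
    rw [Equiv.swap_apply_def]
    split_ifs with h h
    · simp [h]; omega
    · simp [h]; omega
    · rfl
  simp only [this]

theorem kuhnVertex_rotate {d : ℕ} (y : Fin (d + 1) → ℕ) (σ : Equiv.Perm (Fin (d + 1))) (l : ℕ)
    (hl : l ≤ d) :
    kuhnVertex (Function.update y ((σ.trans (finRotate (d + 1))).symm 0)
      (y ((σ.trans (finRotate (d + 1))).symm 0) + 1)) (σ.trans (finRotate (d + 1))) (l + 1) =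
      kuhnVertex y σ l := by
  set τ := σ.trans (finRotate (d + 1)) with hτ
  funext i
  simp only [kuhnVertex]
  have hi : τ i = finRotate (d + 1) (σ i) := rfl
  by_cases h : i = τ.symm 0
  · subst h
    have h2 : finRotate (d + 1) (σ (τ.symm 0)) = finRotate (d + 1) (Fin.last d) := by
      rw [← hi]; simp
    have h3 := (finRotate (d + 1)).injective h2
    simp [h3, hl]
  · have h2 : σ i ≠ Fin.last d := by
      intro e
      apply h
      rw [Equiv.eq_symm_apply, hi, e]
      simp
    rw [Function.update_of_ne h, hi, coe_finRotate_of_ne_last h2]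
    simp

theorem kuhnVertex_insertNth {d : ℕ} (z : Fin d → ℕ) (a : ℕ) (σ : Equiv.Perm (Fin (d + 1)))
    (j : Fin (d + 1)) (hj : σ j = 0) (l : ℕ) :
    kuhnVertex (j.insertNth (α := fun _ => ℕ) a z) σ (l + 1) j = a := by
  simp [kuhnVertex, hj]

theorem kuhnVertex_cons {d : ℕ} (z : Fin d → ℕ) (τ : Equiv.Perm (Fin d)) (a l : ℕ) :
    kuhnVertex (Fin.cons a z : Fin (d + 1) → ℕ) (Equiv.Perm.decomposeFin.symm (0, τ)) (l + 1) =
      Fin.cons a (kuhnVertex z τ l) := by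
  funext i
  refine Fin.cases ?_ (fun i => ?_) i
  · simp [kuhnVertex]
  · simp [kuhnVertex]

theorem sum_piFinset_range_insertNth {d M : ℕ} (j : Fin (d + 1)) (g : (Fin (d + 1) → ℕ) → ZMod 2) :
    ∑ y ∈ Fintype.piFinset (fun _ : Fin (d + 1) => Finset.range M), g y =
      ∑ z ∈ Fintype.piFinset (fun _ : Fin d => Finset.range M), ∑ a ∈ Finset.range M,
        g (j.insertNth (α := fun _ => ℕ) a z) := by
  rw [← Finset.sum_product']
  symm
  refine Finset.sum_equiv ((Equiv.prodComm _ _).trans (Fin.insertNthEquiv (fun _ => ℕ) j)) ?_ ?_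
  · rintro ⟨z, a⟩
    simp [Fintype.mem_piFinset, Fin.forall_iff_succAbove j, and_comm]
  · rintro ⟨z, a⟩ _
    rfl

theorem sum_piFinset_range_telescope {d M : ℕ} (j : Fin (d + 1))
    (g : (Fin (d + 1) → ℕ) → ZMod 2) :
    ∑ y ∈ Fintype.piFinset (fun _ : Fin (d + 1) => Finset.range M),
      (g y + g (Function.update y j (y j + 1))) =
      ∑ z ∈ Fintype.piFinset (fun _ : Fin d => Finset.range M),
        (g (j.insertNth (α := fun _ => ℕ) 0 z) + g (j.insertNth (α := fun _ => ℕ) M z)) := by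
  rw [sum_piFinset_range_insertNth j]
  refine Finset.sum_congr rfl fun z _ => ?_
  have := Finset.sum_range_sub (fun a => g (j.insertNth (α := fun _ => ℕ) a z)) M
  simp only [CharTwo.sub_eq_add] at this
  rw [add_comm (g _) (g _), ← this]
  refine Finset.sum_congr rfl fun a _ => ?_
  simp [add_comm (g _) (g _)]

open Classical in
/-- Kuhn's cubical version of Sperner's lemma: the number of simplices with all labels is odd. -/
theorem sum_surjective_kuhn_eq_one (d M : ℕ) :
    ∀ (ℓ : (Fin d → ℕ) → Fin (d + 1)), (∀ x i, x i = 0 → i.castSucc < ℓ x) →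
      (∀ x i, x i = M → ℓ x ≠ i.succ) →
    ∑ σ : Equiv.Perm (Fin d), ∑ y ∈ Fintype.piFinset (fun _ : Fin d => Finset.range M),
      (if Function.Surjective (fun k : Fin (d + 1) => ℓ (kuhnVertex y σ k))
        then (1 : ZMod 2) else 0) = 1 := by
  induction d with
  | zero =>
    intro ℓ _ _
    have : ∀ f : Fin 1 → Fin 1, Function.Surjective f := fun f c => ⟨0, Subsingleton.elim _ _⟩
    simp [this]
  | succ d ih =>
    intro ℓ h0 h1
    let D : Fin (d + 2) → Equiv.Perm (Fin (d + 1)) → (Fin (d + 1) → ℕ) → ZMod 2 := fun k σ y =>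
      if IsDoor (fun l : Fin (d + 2) => ℓ (kuhnVertex y σ l)) k then 1 else 0
    let E : Equiv.Perm (Fin (d + 1)) → (Fin (d + 1) → ℕ) → ZMod 2 := fun σ y =>
      if ∀ c : Fin (d + 1), ∃ l : Fin (d + 1), ℓ (kuhnVertex y σ (l + 1)) = c.succ then 1 else 0
    have hD0 : ∀ σ y, D 0 σ y = E σ y := by
      intro σ y
      refine if_congr ?_ rfl rfl
      simp [IsDoor, Fin.forall_fin_succ, Fin.exists_fin_succ]
    have hDlast : ∀ σ y, D (Fin.last _) σ y = E (σ.trans (finRotate (d + 1)))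
        (Function.update y ((σ.trans (finRotate (d + 1))).symm 0)
        (y ((σ.trans (finRotate (d + 1))).symm 0) + 1)) := by
      intro σ y
      refine if_congr ?_ rfl rfl
      constructor
      · intro h c
        obtain ⟨l, hl, e⟩ := h c.succ (Fin.succ_ne_zero c)
        obtain ⟨l, rfl⟩ := Fin.exists_castSucc_eq.2 hl
        exact ⟨l, by rw [kuhnVertex_rotate _ _ _ (by omega)]; exact e⟩
      · intro h c hc
        obtain ⟨c, rfl⟩ := Fin.exists_succ_eq.2 hc
        obtain ⟨l, e⟩ := h c
        refine ⟨l.castSucc, (Fin.castSucc_lt_last l).ne, ?_⟩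
        rw [kuhnVertex_rotate _ _ _ (by omega)] at e
        exact e
    have hmid : ∀ (k : Fin d) y, ∑ σ, D k.succ.castSucc σ y = 0 := by
      intro k y
      refine Finset.sum_involution (fun σ _ => σ.trans (Equiv.swap k.castSucc k.succ))
        ?_ ?_ ?_ ?_
      · intro σ _
        have : D k.succ.castSucc (σ.trans (Equiv.swap k.castSucc k.succ)) y =
            D k.succ.castSucc σ y := by
          refine if_congr (forall_congr' fun c => imp_congr_right fun _ => exists_congr fun l =>
            and_congr_right fun hl => ?_) rfl rfl
          have hl' : (l : ℕ) ≠ k + 1 := fun e => hl (Fin.ext (by simpa using e))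
          simp only [kuhnVertex_swap y σ k l hl']
        rw [this, CharTwo.add_self_eq_zero]
      · intro σ _ _ e
        have := congrArg (fun τ : Equiv.Perm _ => τ (σ.symm k.castSucc)) e
        simp [Fin.ext_iff] at this
      · intros; exact Finset.mem_univ _
      · intro σ _
        ext i
        simp
    have hE0 : ∀ σ (z : Fin d → ℕ), σ.symm 0 ≠ 0 →
        E σ ((σ.symm 0).insertNth (α := fun _ => ℕ) 0 z) = 0 := by
      intro σ z hj
      refine if_neg fun h => ?_
      obtain ⟨l, e⟩ := h 0
      have h2 := h0 _ _ (kuhnVertex_insertNth z 0 σ (σ.symm 0) (by simp) l)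
      rw [e] at h2
      apply hj
      rw [Fin.lt_def] at h2
      apply Fin.ext
      simpa using h2
    have hEM : ∀ σ (z : Fin d → ℕ), E σ ((σ.symm 0).insertNth (α := fun _ => ℕ) M z) = 0 := by
      intro σ z
      refine if_neg fun h => ?_
      obtain ⟨l, e⟩ := h (σ.symm 0)
      exact h1 _ _ (kuhnVertex_insertNth z M σ (σ.symm 0) (by simp) l) e
    have hne : ∀ z : Fin d → ℕ, ℓ (Fin.cons 0 z) ≠ 0 := fun z =>
      (lt_of_le_of_lt (Fin.zero_le _) (h0 (Fin.cons 0 z) 0 rfl)).ne'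
    have key := ih (fun z => (ℓ (Fin.cons 0 z)).pred (hne z))
      (fun x i hx => by
        have := h0 (Fin.cons 0 x) i.succ (by simpa using hx)
        simp only [Fin.lt_def, Fin.val_castSucc, Fin.val_succ, Fin.val_pred] at this ⊢
        omega)
      (fun x i hx e => by
        refine h1 (Fin.cons 0 x) i.succ (by simpa using hx) ?_
        rw [← e, Fin.succ_pred])
    calc _ = ∑ σ, ∑ y ∈ Fintype.piFinset (fun _ : Fin (d + 1) => Finset.range M),
          ∑ k, D k σ y := by
          refine Finset.sum_congr rfl fun σ _ => Finset.sum_congr rfl fun y _ => ?_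
          exact sum_isDoor _
      _ = ∑ k, ∑ σ, ∑ y ∈ Fintype.piFinset (fun _ : Fin (d + 1) => Finset.range M),
          D k σ y := by
          rw [Finset.sum_congr rfl fun σ _ => Finset.sum_comm]
          exact Finset.sum_comm
      _ = ∑ σ, ∑ y ∈ Fintype.piFinset (fun _ : Fin (d + 1) => Finset.range M), E σ y +
          ∑ σ, ∑ y ∈ Fintype.piFinset (fun _ : Fin (d + 1) => Finset.range M),
            E σ (Function.update y (σ.symm 0) (y (σ.symm 0) + 1)) := by
          rw [Fin.sum_univ_castSucc, Fin.sum_univ_succ]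
          have hz : ∑ k : Fin d, ∑ σ, ∑ y ∈ Fintype.piFinset
              (fun _ : Fin (d + 1) => Finset.range M), D k.succ.castSucc σ y = 0 := by
            refine Finset.sum_eq_zero fun k _ => ?_
            rw [Finset.sum_comm]
            exact Finset.sum_eq_zero fun y _ => hmid k y
          rw [hz, add_zero]
          congr 1
          · exact Finset.sum_congr rfl fun σ _ => Finset.sum_congr rfl fun y _ => hD0 σ y
          · simp only [hDlast]
            exact Fintype.sum_equiv (Equiv.mulLeft (finRotate (d + 1))) _ _ fun σ => rfl
      _ = ∑ σ : Equiv.Perm (Fin (d + 1)),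
          ∑ z ∈ Fintype.piFinset (fun _ : Fin d => Finset.range M),
            E σ ((σ.symm 0).insertNth (α := fun _ => ℕ) 0 z) := by
          rw [← Finset.sum_add_distrib]
          refine Finset.sum_congr rfl fun σ _ => ?_
          rw [← Finset.sum_add_distrib, sum_piFinset_range_telescope]
          simp only [hEM, add_zero]
      _ = ∑ τ : Equiv.Perm (Fin d), ∑ z ∈ Fintype.piFinset (fun _ : Fin d => Finset.range M),
            E (Equiv.Perm.decomposeFin.symm (0, τ)) (Fin.cons 0 z : Fin (d + 1) → ℕ) := by
          rw [← Equiv.sum_comp Equiv.Perm.decomposeFin.symm, Fintype.sum_prod_type,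
            Finset.sum_eq_single 0]
          · refine Finset.sum_congr rfl fun τ _ => Finset.sum_congr rfl fun z _ => ?_
            have : (Equiv.Perm.decomposeFin.symm (0, τ)).symm 0 = 0 := by
              rw [Equiv.symm_apply_eq]; simp
            rw [this, Fin.insertNth_zero']
          · intro p _ hp
            refine Finset.sum_eq_zero fun τ _ => Finset.sum_eq_zero fun z _ => hE0 _ _ ?_
            rw [Ne, Equiv.symm_apply_eq]
            simpa using hp.symm
          · simp
      _ = 1 := by
          rw [← key]
          refine Finset.sum_congr rfl fun τ _ => Finset.sum_congr rfl fun z _ => ?_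
          refine if_congr (forall_congr' fun c => exists_congr fun l => ?_) rfl rfl
          rw [kuhnVertex_cons]
          rw [Fin.pred_eq_iff_eq_succ]

theorem exists_surjective_kuhn {d M : ℕ} (ℓ : (Fin d → ℕ) → Fin (d + 1))
    (h0 : ∀ x i, x i = 0 → i.castSucc < ℓ x) (h1 : ∀ x i, x i = M → ℓ x ≠ i.succ) :
    ∃ (σ : Equiv.Perm (Fin d)) (y : Fin d → ℕ),
      Function.Surjective (fun k : Fin (d + 1) => ℓ (kuhnVertex y σ k)) := by
  classical
  by_contra! h
  have := sum_surjective_kuhn_eq_one d M ℓ h0 h1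
  simp [h] at this


theorem sum_kuhnVertex {d : ℕ} (y : Fin d → ℕ) (σ : Equiv.Perm (Fin d)) (k : ℕ) :
    ∑ i, kuhnVertex y σ k i = ∑ i, y i + (d - k) := by
  simp only [kuhnVertex, Finset.sum_add_distrib]
  congr 1
  rw [Equiv.sum_comp σ (fun i : Fin d => if k ≤ (i : ℕ) then 1 else 0),
    Fin.sum_univ_eq_sum_range (fun i => if k ≤ i then 1 else 0), Finset.sum_boole,
    Finset.range_eq_Ico, Finset.Ico_filter_le]
  simp

/-- The items of the path lying strictly between the cuts `f j` and `f (j + 1)`; the item `v`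
occupies the segment from `2 * v` to `2 * v + 2`. -/
def cutBundle {m : ℕ} (f : ℕ → ℕ) (j : ℕ) : Finset (Fin m) :=
  Finset.univ.filter fun v => f j ≤ 2 * v ∧ 2 * (v : ℕ) + 2 ≤ f (j + 1)

theorem mem_cutBundle {m : ℕ} {f : ℕ → ℕ} {j : ℕ} {v : Fin m} :
    v ∈ cutBundle f j ↔ f j ≤ 2 * v ∧ 2 * (v : ℕ) + 2 ≤ f (j + 1) := by
  simp [cutBundle]

theorem cutBundle_eq_empty {m : ℕ} {f : ℕ → ℕ} {j : ℕ} (h : f (j + 1) ≤ f j) :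
    (cutBundle f j : Finset (Fin m)) = ∅ := by
  ext v
  simp only [mem_cutBundle, Finset.notMem_empty, iff_false]
  omega

/-- The sequence of cuts given by the knife positions `x`, each knife being pushed to the left of
all later ones. -/
def cuts {d : ℕ} (M : ℕ) (x : Fin d → ℕ) (t : ℕ) : ℕ :=
  if t = 0 then 0 else (Finset.univ.filter fun i : Fin d => t ≤ i + 1).fold min M x

section cuts

variable {d M : ℕ} (x : Fin d → ℕ)

theorem cuts_zero : cuts M x 0 = 0 := rfl

theorem le_cuts_succ {c t : ℕ} :
    c ≤ cuts M x (t + 1) ↔ c ≤ M ∧ ∀ i : Fin d, t ≤ i → c ≤ x i := by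
  simp [cuts, Finset.le_fold_min]

theorem cuts_last : cuts M x (d + 1) = M :=
  le_antisymm ((le_cuts_succ x).1 le_rfl).1
    ((le_cuts_succ x).2 ⟨le_rfl, fun i hi => absurd i.2 (by omega)⟩)

theorem monotone_cuts : Monotone (cuts M x) := by
  refine monotone_nat_of_le_succ fun t => ?_
  cases t with
  | zero => exact Nat.zero_le _
  | succ t =>
    have := (le_cuts_succ (M := M) x (t := t)).1 le_rfl
    exact (le_cuts_succ x).2 ⟨this.1, fun i hi => this.2 i (by omega)⟩

theorem cuts_eq_zero {i : Fin d} (h : x i = 0) : cuts M x (i + 1) = 0 :=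
  Nat.le_zero.1 (h ▸ ((le_cuts_succ (M := M) x).1 le_rfl).2 i le_rfl)

theorem cuts_le_of_eq {i : Fin d} (h : x i = M) : cuts M x (i + 1 + 1) ≤ cuts M x (i + 1) := by
  have := (le_cuts_succ (M := M) x (t := i + 1)).1 le_rfl
  refine (le_cuts_succ x).2 ⟨this.1, fun l hl => ?_⟩
  rcases hl.eq_or_lt with e | hl
  · rw [← Fin.ext e, h]
    exact this.1
  · exact this.2 l hl

theorem cuts_mono {y : Fin d → ℕ} (h : ∀ i, y i ≤ x i) (t : ℕ) : cuts M y t ≤ cuts M x t := by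
  cases t with
  | zero => exact le_rfl
  | succ t =>
    have := (le_cuts_succ (M := M) y (t := t)).1 le_rfl
    exact (le_cuts_succ x).2 ⟨this.1, fun i hi => (this.2 i hi).trans (h i)⟩

theorem cuts_le_add_one {y : Fin d → ℕ} (h : ∀ i, x i ≤ y i + 1) (t : ℕ) :
    cuts M x t ≤ cuts M y t + 1 := by
  cases t with
  | zero => exact Nat.zero_le _
  | succ t =>
    have := (le_cuts_succ (M := M) x (t := t)).1 le_rfl
    rw [← Nat.sub_le_iff_le_add]
    refine (le_cuts_succ y).2 ⟨by omega, fun i hi => ?_⟩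
    have := (this.2 i hi).trans (h i)
    omega

end cuts

theorem exists_lt_succ_of_lt {f : ℕ → ℕ} {a n : ℕ} (h0 : f 0 ≤ a) (hn : a < f n) :
    ∃ j < n, f j ≤ a ∧ a < f (j + 1) := by
  induction n with
  | zero => omega
  | succ n ih =>
    by_cases h : a < f n
    · obtain ⟨j, hj, h⟩ := ih h
      exact ⟨j, by omega, h⟩
    · exact ⟨n, by omega, by omega, hn⟩

/-- An agent with a monotonic valuation has a favourite bundle among those cut out by `f`, and
this bundle may be chosen nondegenerate. -/
theorem exists_favourite {m d : ℕ} {u : Finset (Fin m) → ℝ} (hu : Monotonic u) {f : ℕ → ℕ}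
    (h0 : f 0 = 0) (hf : 0 < f (d + 1)) :
    ∃ j : Fin (d + 1), f j < f (j + 1) ∧
      ∀ l : Fin (d + 1), u (cutBundle f l) ≤ u (cutBundle f j) := by
  have hne : (Finset.univ.filter fun j : Fin (d + 1) => f j < f (j + 1)).Nonempty := by
    obtain ⟨j, hj, h⟩ := exists_lt_succ_of_lt h0.le hf
    exact ⟨⟨j, hj⟩, by simp; omega⟩
  obtain ⟨j, hj, hmax⟩ := Finset.exists_max_image _ (fun j : Fin (d + 1) => u (cutBundle f j)) hne
  refine ⟨j, (Finset.mem_filter.1 hj).2, fun l => ?_⟩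
  by_cases h : f l < f (l + 1)
  · exact hmax l (by simpa using h)
  · rw [cutBundle_eq_empty (not_lt.1 h)]
    exact hu _ _ (Finset.empty_subset _)

/-- There are bundles cut out by sequences of cuts within distance one of a common sequence such
that every agent has a different favourite bundle. -/
theorem exists_almost_envyFree_cuts {d m : ℕ} (hm : 0 < m) (u : Fin (d + 1) → Finset (Fin m) → ℝ)
    (hu : ∀ i, Monotonic (u i)) :
    ∃ (f : ℕ → ℕ) (g : Fin (d + 1) → ℕ → ℕ) (β : Fin (d + 1) → Fin (d + 1)),
      Monotone f ∧ f 0 = 0 ∧ f (d + 1) = 2 * m ∧ Function.Bijective β ∧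
      (∀ i t, f t ≤ g i t ∧ g i t ≤ f t + 1) ∧
      ∀ i j : Fin (d + 1), u i (cutBundle (g i) j) ≤ u i (cutBundle (g i) (β i)) := by
  let o : (Fin d → ℕ) → Fin (d + 1) := fun x => Fin.ofNat (d + 1) (∑ i, x i)
  have hfav : ∀ x : Fin d → ℕ, ∃ j : Fin (d + 1),
      cuts (2 * m) x j < cuts (2 * m) x (j + 1) ∧
      ∀ l : Fin (d + 1), u (o x) (cutBundle (cuts (2 * m) x) l) ≤
        u (o x) (cutBundle (cuts (2 * m) x) j) := fun x =>
    exists_favourite (hu _) (cuts_zero x) (by rw [cuts_last]; omega)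
  choose ℓ hℓ hfav using hfav
  obtain ⟨σ, y, hs⟩ := exists_surjective_kuhn (M := 2 * m) ℓ
    (fun x i hx => by
      by_contra! h
      have h1 := hℓ x
      have h2 := monotone_cuts (M := 2 * m) x (Nat.succ_le_succ (Fin.le_def.1 h))
      have h3 := cuts_eq_zero (M := 2 * m) x hx
      simp only [Fin.val_castSucc, Nat.succ_eq_add_one] at h2
      omega)
    (fun x i hx e => by
      have h1 := hℓ x
      have h2 := cuts_le_of_eq x hx
      rw [e, Fin.val_succ] at h1
      omega)
  have ho : Function.Bijective fun k : Fin (d + 1) => o (kuhnVertex y σ k) := by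
    rw [← Finite.injective_iff_bijective]
    intro k l h
    have h := congrArg Fin.val h
    simp only [o, Fin.val_ofNat, sum_kuhnVertex] at h
    have h2 : (d - k) ≡ (d - l) [MOD d + 1] := Nat.ModEq.add_left_cancel' _ h
    have h3 := h2.eq_of_lt_of_lt (by omega) (by omega)
    apply Fin.ext
    omega
  let κ := (Equiv.ofBijective _ ho).symm
  have hκ : ∀ i, o (kuhnVertex y σ (κ i)) = i := (Equiv.ofBijective _ ho).apply_symm_apply
  refine ⟨cuts (2 * m) y, fun i => cuts (2 * m) (kuhnVertex y σ (κ i)),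
    fun i => ℓ (kuhnVertex y σ (κ i)), monotone_cuts y, cuts_zero y, cuts_last y, ?_, ?_, ?_⟩
  · exact (Finite.surjective_iff_bijective.1 hs).comp κ.bijective
  · intro i t
    refine ⟨cuts_mono _ (fun j => ?_) t, cuts_le_add_one _ (fun j => ?_) t⟩
    · simp [kuhnVertex]
    · simp only [kuhnVertex]
      split_ifs <;> omega
  · intro i j
    have := hfav (kuhnVertex y σ (κ i)) j
    rwa [hκ] at this

theorem isInterval_cutBundle {m : ℕ} (f : ℕ → ℕ) (j : ℕ) :
    IsInterval (cutBundle f j : Finset (Fin m)) := by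
  intro a b c hab hbc ha hc
  rw [mem_cutBundle] at *
  rw [Fin.le_def] at hab hbc
  omega

theorem isConnAlloc_cutBundle {d m : ℕ} {c : ℕ → ℕ} (hc : Monotone c) (h0 : c 0 = 0)
    (hlast : c (d + 1) = 2 * m) (heven : ∀ t, Even (c t)) {β : Fin (d + 1) → Fin (d + 1)}
    (hβ : Function.Bijective β) :
    IsConnAlloc fun i => (cutBundle c (β i) : Finset (Fin m)) := by
  refine ⟨fun i => isInterval_cutBundle _ _, fun i j hij => ?_, fun v => ?_⟩
  · rw [Finset.disjoint_left]
    intro v hi hj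
    rw [mem_cutBundle] at hi hj
    rcases lt_or_gt_of_ne (fun e => hij (hβ.1 (Fin.ext e))) with h | h
    · have := hc (Nat.succ_le_of_lt h)
      simp only [Nat.succ_eq_add_one] at this
      omega
    · have := hc (Nat.succ_le_of_lt h)
      simp only [Nat.succ_eq_add_one] at this
      omega
  · obtain ⟨j, hj, h1, h2⟩ := exists_lt_succ_of_lt (f := c) (a := 2 * v) (n := d + 1)
      (by omega) (by omega)
    obtain ⟨i, hi⟩ := hβ.2 ⟨j, hj⟩
    refine ⟨i, mem_cutBundle.2 ?_⟩
    obtain ⟨r, hr⟩ := heven (j + 1)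
    rw [hi]
    simp only
    omega

/-- on a path of `m` items, for any number `n ≥ 1` of agents with monotonic
valuations, a connected EF2 allocation exists. -/
theorem EF2_exists_on_path {n m : ℕ} (hn : 0 < n)
    (u : Fin n → Finset (Fin m) → ℝ)
    (hmono : ∀ i, Monotonic (u i)) (h0 : ∀ i, u i ∅ = 0) :
    ∃ A : Fin n → Finset (Fin m), IsConnAlloc A ∧ EF2 u A := by
  obtain ⟨d, rfl⟩ := Nat.exists_eq_succ_of_ne_zero hn.ne'
  rcases Nat.eq_zero_or_pos m with rfl | hm
  · refine ⟨fun _ => ∅, ⟨fun _ a => a.elim0, fun _ _ _ => Finset.disjoint_empty_left _,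
      fun v => v.elim0⟩, fun _ _ => Or.inl (by simp)⟩
  obtain ⟨f, g, β, hf, hf0, hflast, hβ, hg, hfav⟩ := exists_almost_envyFree_cuts hm u hmono
  let c : ℕ → ℕ := fun t => 2 * ((f t + 1) / 2)
  have hfc : ∀ t, f t ≤ c t ∧ c t ≤ f t + 1 := fun t => by simp only [c]; omega
  have heven : ∀ t, Even (c t) := fun t => even_two_mul _
  have hcmono : Monotone c := fun s t hst => by
    have := hf hst
    simp only [c]
    omega
  have hclast : c (d + 1) = 2 * m := by
    simp only [c, hflast]
    omega
  refine ⟨fun i => cutBundle c (β i), isConnAlloc_cutBundle hcmono (by simp [c, hf0])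
    hclast heven hβ, fun i j => ?_⟩
  refine or_iff_not_imp_left.2 fun hcard => ?_
  set C : Finset (Fin m) := cutBundle c (β j)
  replace hcard : 1 < C.card := not_le.1 hcard
  have hne : C.Nonempty := Finset.card_pos.1 (by omega)
  refine ⟨C.min' hne, C.min'_mem hne, C.max' hne, C.max'_mem hne,
    (Finset.min'_lt_max'_of_card C hcard).ne, ?_, ?_⟩
  · intro a b e hab hbe ha he
    simp only [Finset.mem_sdiff, Finset.mem_insert, Finset.mem_singleton, not_or] at ha he ⊢
    have hb : b ∈ C := isInterval_cutBundle _ _ a b e hab hbe ha.1 he.1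
    exact ⟨hb, ((lt_of_le_of_ne (C.min'_le a ha.1) (Ne.symm ha.2.1)).trans_le hab).ne',
      (hbe.trans_lt (lt_of_le_of_ne (C.le_max' e he.1) he.2.2)).ne⟩
  · calc u i (C \ {C.min' hne, C.max' hne}) ≤ u i (cutBundle (g i) (β j)) := by
          refine hmono i _ _ fun a ha => ?_
          simp only [Finset.mem_sdiff, Finset.mem_insert, Finset.mem_singleton, not_or] at ha
          have h1 := lt_of_le_of_ne (C.min'_le a ha.1) (Ne.symm ha.2.1)
          have h2 := lt_of_le_of_ne (C.le_max' a ha.1) ha.2.2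
          have h3 := mem_cutBundle.1 (C.min'_mem hne)
          have h4 := mem_cutBundle.1 (C.max'_mem hne)
          have h5 := hfc (β j)
          have h6 := hfc (β j + 1)
          have h7 := hg i (β j)
          have h8 := hg i (β j + 1)
          rw [Fin.lt_def] at h1 h2
          rw [mem_cutBundle]
          omega
      _ ≤ u i (cutBundle (g i) (β i)) := hfav i _
      _ ≤ u i (cutBundle c (β i)) := by
          refine hmono i _ _ fun a ha => ?_
          rw [mem_cutBundle] at ha ⊢
          have h7 := hg i (β i)
          have h8 := hg i (β i + 1)
          simp only [c]
          omega
end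

section
/- On a path of m items, for four agents with monotonic valuations, there exists a connected EF1 allocation. -/
open Finset

section Sperner

/-- The `0`-`1` indicator of a colour. -/
def colourInd (i a : Fin 4) : ℤ := if a = i then 1 else 0

/-- The orientation of an edge coloured `{0, 1}`, and `0` for any other edge. -/
def edgeSign (a b : Fin 4) : ℤ :=
  colourInd 0 a * colourInd 1 b - colourInd 1 a * colourInd 0 b

/-- The orientation of a triangle coloured `{0, 1, 2}`, and `0` for any other triangle. -/
def triSign (a b c : Fin 4) : ℤ :=
  edgeSign a b * colourInd 2 c - edgeSign a c * colourInd 2 b + edgeSign b c * colourInd 2 a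

/-- The orientation of a rainbow tetrahedron, and `0` for any other tetrahedron. -/
def tetSign (a b c d : Fin 4) : ℤ :=
  triSign a b c * colourInd 3 d - triSign a b d * colourInd 3 c
    + triSign a c d * colourInd 3 b - triSign b c d * colourInd 3 a

lemma tetSign_eq : ∀ a b c d : Fin 4,
    tetSign a b c d = triSign a b c - triSign a b d + triSign a c d - triSign b c d := by
  decide

lemma triSign_eq : ∀ a b c : Fin 4, a ≠ 3 → b ≠ 3 → c ≠ 3 →
    triSign a b c = edgeSign a b - edgeSign a c + edgeSign b c := by
  decide

lemma edgeSign_eq : ∀ a b : Fin 4, a ≠ 2 → a ≠ 3 → b ≠ 2 → b ≠ 3 →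
    edgeSign a b = colourInd 0 a - colourInd 0 b := by
  decide

lemma triSign_eq_zero : ∀ k : Fin 4, k ≠ 3 → ∀ a b c : Fin 4, a ≠ k → b ≠ k → c ≠ k →
    triSign a b c = 0 := by
  decide

lemma edgeSign_eq_zero : ∀ k : Fin 4, k ≠ 2 → k ≠ 3 → ∀ a b : Fin 4, a ≠ k → b ≠ k →
    edgeSign a b = 0 := by
  decide

lemma injective_of_tetSign_ne_zero : ∀ a b c d : Fin 4, tetSign a b c d ≠ 0 →
    Function.Injective ![a, b, c, d] := by
  have key : ∀ a b c d : Fin 4, tetSign a b c d ≠ 0 →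
      a ≠ b ∧ a ≠ c ∧ a ≠ d ∧ b ≠ c ∧ b ≠ d ∧ c ≠ d := by decide
  intro a b c d h
  obtain ⟨h1, h2, h3, h4, h5, h6⟩ := key a b c d h
  intro i j hij
  fin_cases i <;> fin_cases j <;> simp_all

/-- The signed number of `{0, 1, 2}`-coloured triangles of a triangulated unit square. -/
def squareSign (a b c d : Fin 4) : ℤ := triSign a b d - triSign a c d

/-- The signed number of rainbow tetrahedra in the Kuhn triangulation of a unit cube. -/
def cubeSign (f : ℕ → ℕ → ℕ → Fin 4) (x y z : ℕ) : ℤ :=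
  tetSign (f x y z) (f (x + 1) y z) (f (x + 1) (y + 1) z) (f (x + 1) (y + 1) (z + 1))
  - tetSign (f x y z) (f (x + 1) y z) (f (x + 1) y (z + 1)) (f (x + 1) (y + 1) (z + 1))
  - tetSign (f x y z) (f x (y + 1) z) (f (x + 1) (y + 1) z) (f (x + 1) (y + 1) (z + 1))
  + tetSign (f x y z) (f x (y + 1) z) (f x (y + 1) (z + 1)) (f (x + 1) (y + 1) (z + 1))
  + tetSign (f x y z) (f x y (z + 1)) (f (x + 1) y (z + 1)) (f (x + 1) (y + 1) (z + 1))
  - tetSign (f x y z) (f x y (z + 1)) (f x (y + 1) (z + 1)) (f (x + 1) (y + 1) (z + 1))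

/-- Discrete Stokes formula on a unit cube. -/
lemma cubeSign_eq (f : ℕ → ℕ → ℕ → Fin 4) (x y z : ℕ) :
    cubeSign f x y z =
      -(squareSign (f x y (z + 1)) (f (x + 1) y (z + 1)) (f x (y + 1) (z + 1))
            (f (x + 1) (y + 1) (z + 1))
          - squareSign (f x y z) (f (x + 1) y z) (f x (y + 1) z) (f (x + 1) (y + 1) z))
      + (squareSign (f x (y + 1) z) (f (x + 1) (y + 1) z) (f x (y + 1) (z + 1))
            (f (x + 1) (y + 1) (z + 1))
          - squareSign (f x y z) (f (x + 1) y z) (f x y (z + 1)) (f (x + 1) y (z + 1)))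
      - (squareSign (f (x + 1) y z) (f (x + 1) (y + 1) z) (f (x + 1) y (z + 1))
            (f (x + 1) (y + 1) (z + 1))
          - squareSign (f x y z) (f x (y + 1) z) (f x y (z + 1)) (f x (y + 1) (z + 1))) := by
  simp only [cubeSign, squareSign, tetSign_eq]
  ring

lemma squareSign_eq_zero {k : Fin 4} (hk : k ≠ 3) {a b c d : Fin 4}
    (ha : a ≠ k) (hb : b ≠ k) (hc : c ≠ k) (hd : d ≠ k) : squareSign a b c d = 0 := by
  simp only [squareSign, triSign_eq_zero k hk _ _ _ ha hb hd, triSign_eq_zero k hk _ _ _ ha hc hd,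
    sub_zero]

/-- Discrete Stokes formula on a unit square without colour `3`. -/
lemma squareSign_eq {a b c d : Fin 4} (ha : a ≠ 3) (hb : b ≠ 3) (hc : c ≠ 3) (hd : d ≠ 3) :
    squareSign a b c d =
      (edgeSign b d - edgeSign a c) - (edgeSign c d - edgeSign a b) := by
  simp only [squareSign, triSign_eq _ _ _ ha hb hd, triSign_eq _ _ _ ha hc hd]
  ring

lemma sum_range_succ_sub_eq_zero {M : ℕ} (F : ℕ → ℤ) (h0 : F 0 = 0) (hM : F M = 0) :
    ∑ x ∈ range M, (F (x + 1) - F x) = 0 := by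
  rw [sum_range_sub, h0, hM, sub_zero]

/-- Admissible colourings of the grid `{0, …, M}³`: on each of the six faces of the cube some
colour is missing. -/
structure IsAdmissible (M : ℕ) (f : ℕ → ℕ → ℕ → Fin 4) : Prop where
  x_zero : ∀ y ≤ M, ∀ z ≤ M, f 0 y z ≠ 0
  x_top : ∀ y ≤ M, ∀ z ≤ M, f M y z ≠ 1
  y_zero : ∀ x ≤ M, ∀ z ≤ M, f x 0 z ≠ 1
  y_top : ∀ x ≤ M, ∀ z ≤ M, f x M z ≠ 2
  z_zero : ∀ x ≤ M, ∀ y ≤ M, f x y 0 ≠ 2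
  z_top : ∀ x ≤ M, ∀ y ≤ M, f x y M ≠ 3

lemma IsAdmissible.sum_edgeSign {M : ℕ} {f : ℕ → ℕ → ℕ → Fin 4} (hf : IsAdmissible M f) :
    ∑ x ∈ range M, edgeSign (f x M M) (f (x + 1) M M) = -1 := by
  have h : ∀ x ∈ range M, edgeSign (f x M M) (f (x + 1) M M) =
      -(colourInd 0 (f (x + 1) M M) - colourInd 0 (f x M M)) := by
    intro x hx
    have hx := mem_range.1 hx
    rw [edgeSign_eq _ _ (hf.y_top _ (by omega) _ le_rfl) (hf.z_top _ (by omega) _ le_rfl)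
      (hf.y_top _ (by omega) _ le_rfl) (hf.z_top _ (by omega) _ le_rfl)]
    ring
  rw [sum_congr rfl h, sum_neg_distrib, sum_range_sub (fun x => colourInd 0 (f x M M))]
  have h0 := hf.x_zero M le_rfl M le_rfl
  have h1 := hf.x_top M le_rfl M le_rfl
  have h2 := hf.y_top M le_rfl M le_rfl
  have h3 := hf.z_top M le_rfl M le_rfl
  have h4 : f M M M = 0 := by
    revert h1 h2 h3
    generalize f M M M = a
    revert a
    decide
  simp [colourInd, h0, h4]

lemma IsAdmissible.sum_squareSign {M : ℕ} {f : ℕ → ℕ → ℕ → Fin 4} (hf : IsAdmissible M f) :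
    ∑ x ∈ range M, ∑ y ∈ range M,
      squareSign (f x y M) (f (x + 1) y M) (f x (y + 1) M) (f (x + 1) (y + 1) M) = 1 := by
  have h : ∀ x ∈ range M, ∀ y ∈ range M,
      squareSign (f x y M) (f (x + 1) y M) (f x (y + 1) M) (f (x + 1) (y + 1) M) =
        (edgeSign (f (x + 1) y M) (f (x + 1) (y + 1) M) - edgeSign (f x y M) (f x (y + 1) M))
        - (edgeSign (f x (y + 1) M) (f (x + 1) (y + 1) M)
            - edgeSign (f x y M) (f (x + 1) y M)) := by
    intro x hx y hy
    have hx := mem_range.1 hx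
    have hy := mem_range.1 hy
    exact squareSign_eq (hf.z_top _ (by omega) _ (by omega)) (hf.z_top _ (by omega) _ (by omega))
      (hf.z_top _ (by omega) _ (by omega)) (hf.z_top _ (by omega) _ (by omega))
  have hK : ∑ x ∈ range M, ∑ y ∈ range M,
      (edgeSign (f (x + 1) y M) (f (x + 1) (y + 1) M) - edgeSign (f x y M) (f x (y + 1) M))
        = 0 := by
    rw [sum_comm]
    refine sum_eq_zero fun y hy => ?_
    have hy := mem_range.1 hy
    exact sum_range_succ_sub_eq_zero (fun x => edgeSign (f x y M) (f x (y + 1) M))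
      (edgeSign_eq_zero 0 (by decide) (by decide) _ _
        (hf.x_zero _ (by omega) _ le_rfl) (hf.x_zero _ (by omega) _ le_rfl))
      (edgeSign_eq_zero 1 (by decide) (by decide) _ _
        (hf.x_top _ (by omega) _ le_rfl) (hf.x_top _ (by omega) _ le_rfl))
  have hH : ∑ x ∈ range M, ∑ y ∈ range M,
      (edgeSign (f x (y + 1) M) (f (x + 1) (y + 1) M) - edgeSign (f x y M) (f (x + 1) y M))
        = -1 := by
    rw [← hf.sum_edgeSign]
    refine sum_congr rfl fun x hx => ?_
    have hx := mem_range.1 hx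
    rw [sum_range_sub (fun y => edgeSign (f x y M) (f (x + 1) y M)),
      edgeSign_eq_zero 1 (by decide) (by decide) (f x 0 M) _
        (hf.y_zero _ (by omega) _ le_rfl) (hf.y_zero _ (by omega) _ le_rfl), sub_zero]
  rw [sum_congr rfl fun x hx => sum_congr rfl (h x hx)]
  simp only [sum_sub_distrib] at hK hH ⊢
  linarith

lemma IsAdmissible.sum_cubeSign {M : ℕ} {f : ℕ → ℕ → ℕ → Fin 4} (hf : IsAdmissible M f) :
    ∑ x ∈ range M, ∑ y ∈ range M, ∑ z ∈ range M, cubeSign f x y z = -1 := by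
  have hZ : ∑ x ∈ range M, ∑ y ∈ range M, ∑ z ∈ range M,
      (squareSign (f x y (z + 1)) (f (x + 1) y (z + 1)) (f x (y + 1) (z + 1))
            (f (x + 1) (y + 1) (z + 1))
          - squareSign (f x y z) (f (x + 1) y z) (f x (y + 1) z) (f (x + 1) (y + 1) z)) = 1 := by
    rw [← hf.sum_squareSign]
    refine sum_congr rfl fun x hx => sum_congr rfl fun y hy => ?_
    have hx := mem_range.1 hx
    have hy := mem_range.1 hy
    rw [sum_range_sub (fun z =>
        squareSign (f x y z) (f (x + 1) y z) (f x (y + 1) z) (f (x + 1) (y + 1) z)),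
      squareSign_eq_zero (k := 2) (a := f x y 0) (by decide)
        (hf.z_zero _ (by omega) _ (by omega)) (hf.z_zero _ (by omega) _ (by omega))
        (hf.z_zero _ (by omega) _ (by omega)) (hf.z_zero _ (by omega) _ (by omega)), sub_zero]
  have hY : ∑ x ∈ range M, ∑ y ∈ range M, ∑ z ∈ range M,
      (squareSign (f x (y + 1) z) (f (x + 1) (y + 1) z) (f x (y + 1) (z + 1))
            (f (x + 1) (y + 1) (z + 1))
          - squareSign (f x y z) (f (x + 1) y z) (f x y (z + 1)) (f (x + 1) y (z + 1))) = 0 := by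
    refine sum_eq_zero fun x hx => ?_
    rw [sum_comm]
    refine sum_eq_zero fun z hz => ?_
    have hx := mem_range.1 hx
    have hz := mem_range.1 hz
    exact sum_range_succ_sub_eq_zero (fun y =>
        squareSign (f x y z) (f (x + 1) y z) (f x y (z + 1)) (f (x + 1) y (z + 1)))
      (squareSign_eq_zero (k := 1) (by decide)
        (hf.y_zero _ (by omega) _ (by omega)) (hf.y_zero _ (by omega) _ (by omega))
        (hf.y_zero _ (by omega) _ (by omega)) (hf.y_zero _ (by omega) _ (by omega)))
      (squareSign_eq_zero (k := 2) (by decide)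
        (hf.y_top _ (by omega) _ (by omega)) (hf.y_top _ (by omega) _ (by omega))
        (hf.y_top _ (by omega) _ (by omega)) (hf.y_top _ (by omega) _ (by omega)))
  have hX : ∑ x ∈ range M, ∑ y ∈ range M, ∑ z ∈ range M,
      (squareSign (f (x + 1) y z) (f (x + 1) (y + 1) z) (f (x + 1) y (z + 1))
            (f (x + 1) (y + 1) (z + 1))
          - squareSign (f x y z) (f x (y + 1) z) (f x y (z + 1)) (f x (y + 1) (z + 1))) = 0 := by
    rw [sum_comm]
    refine sum_eq_zero fun y hy => ?_
    rw [sum_comm]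
    refine sum_eq_zero fun z hz => ?_
    have hy := mem_range.1 hy
    have hz := mem_range.1 hz
    exact sum_range_succ_sub_eq_zero (fun x =>
        squareSign (f x y z) (f x (y + 1) z) (f x y (z + 1)) (f x (y + 1) (z + 1)))
      (squareSign_eq_zero (k := 0) (by decide)
        (hf.x_zero _ (by omega) _ (by omega)) (hf.x_zero _ (by omega) _ (by omega))
        (hf.x_zero _ (by omega) _ (by omega)) (hf.x_zero _ (by omega) _ (by omega)))
      (squareSign_eq_zero (k := 1) (by decide)
        (hf.x_top _ (by omega) _ (by omega)) (hf.x_top _ (by omega) _ (by omega))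
        (hf.x_top _ (by omega) _ (by omega)) (hf.x_top _ (by omega) _ (by omega)))
  simp only [cubeSign_eq, sum_add_distrib, sum_sub_distrib, sum_neg_distrib] at hX hY hZ ⊢
  linarith

/-- A Sperner-type lemma for the Kuhn triangulation of a cube: an admissible colouring has a
rainbow tetrahedron, whose vertices `p 0, …, p 3` lie in a common unit cube and increase by one
unit in one coordinate at each step. -/
theorem IsAdmissible.exists_rainbow {M : ℕ} {f : ℕ → ℕ → ℕ → Fin 4} (hf : IsAdmissible M f) :
    ∃ a < M, ∃ b < M, ∃ c < M, ∃ p q r : Fin 4 → ℕ,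
      (∀ s, (a ≤ p s ∧ p s ≤ a + 1) ∧ (b ≤ q s ∧ q s ≤ b + 1) ∧ (c ≤ r s ∧ r s ≤ c + 1) ∧
        p s + q s + r s = a + b + c + s) ∧
      Function.Injective fun s => f (p s) (q s) (r s) := by
  have hne : ∑ x ∈ range M, ∑ y ∈ range M, ∑ z ∈ range M, cubeSign f x y z ≠ 0 := by
    rw [hf.sum_cubeSign]
    decide
  obtain ⟨a, ha, hne⟩ := exists_ne_zero_of_sum_ne_zero hne
  obtain ⟨b, hb, hne⟩ := exists_ne_zero_of_sum_ne_zero hne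
  obtain ⟨c, hc, hne⟩ := exists_ne_zero_of_sum_ne_zero hne
  refine ⟨a, mem_range.1 ha, b, mem_range.1 hb, c, mem_range.1 hc, ?_⟩
  have key : ∀ p q r : Fin 4 → ℕ,
      tetSign (f (p 0) (q 0) (r 0)) (f (p 1) (q 1) (r 1)) (f (p 2) (q 2) (r 2))
        (f (p 3) (q 3) (r 3)) ≠ 0 → Function.Injective fun s => f (p s) (q s) (r s) := by
    intro p q r h
    convert injective_of_tetSign_ne_zero _ _ _ _ h using 1
    ext s
    fin_cases s <;> rfl
  by_contra hcon
  have hz : ∀ p q r : Fin 4 → ℕ,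
      (∀ s, (a ≤ p s ∧ p s ≤ a + 1) ∧ (b ≤ q s ∧ q s ≤ b + 1) ∧ (c ≤ r s ∧ r s ≤ c + 1) ∧
        p s + q s + r s = a + b + c + s) →
      tetSign (f (p 0) (q 0) (r 0)) (f (p 1) (q 1) (r 1)) (f (p 2) (q 2) (r 2))
        (f (p 3) (q 3) (r 3)) = 0 := by
    intro p q r h
    by_contra h'
    exact hcon ⟨p, q, r, h, key p q r h'⟩
  apply hne
  have h1 := hz ![a, a + 1, a + 1, a + 1] ![b, b, b + 1, b + 1] ![c, c, c, c + 1]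
    (by simp [Fin.forall_fin_succ]; omega)
  have h2 := hz ![a, a + 1, a + 1, a + 1] ![b, b, b, b + 1] ![c, c, c + 1, c + 1]
    (by simp [Fin.forall_fin_succ]; omega)
  have h3 := hz ![a, a, a + 1, a + 1] ![b, b + 1, b + 1, b + 1] ![c, c, c, c + 1]
    (by simp [Fin.forall_fin_succ]; omega)
  have h4 := hz ![a, a, a, a + 1] ![b, b + 1, b + 1, b + 1] ![c, c, c + 1, c + 1]
    (by simp [Fin.forall_fin_succ]; omega)
  have h5 := hz ![a, a, a + 1, a + 1] ![b, b, b, b + 1] ![c, c + 1, c + 1, c + 1]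
    (by simp [Fin.forall_fin_succ]; omega)
  have h6 := hz ![a, a, a, a + 1] ![b, b, b + 1, b + 1] ![c, c + 1, c + 1, c + 1]
    (by simp [Fin.forall_fin_succ]; omega)
  simp at h1 h2 h3 h4 h5 h6
  simp [cubeSign, h1, h2, h3, h4, h5, h6]

end Sperner

section Bundles

/-- The bundle of the items `v` with `l ≤ v < r`. -/
def itemsBetween (m l r : ℕ) : Finset (Fin m) := {v | l ≤ v.val ∧ v.val < r}

lemma mem_itemsBetween {m l r : ℕ} {v : Fin m} :
    v ∈ itemsBetween m l r ↔ l ≤ v.val ∧ v.val < r := by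
  simp [itemsBetween]

lemma isInterval_itemsBetween (m l r : ℕ) : IsInterval (itemsBetween m l r) := by
  intro a b c hab hbc ha hc
  rw [mem_itemsBetween] at *
  rw [Fin.le_def] at hab hbc
  omega

lemma itemsBetween_eq_empty {m l r : ℕ} (h : r ≤ l) : itemsBetween m l r = ∅ := by
  ext v
  simp only [mem_itemsBetween, notMem_empty, iff_false]
  omega

lemma itemsBetween_subset {m l r l' r' : ℕ} (hl : l' ≤ l) (hr : r ≤ r') :
    itemsBetween m l r ⊆ itemsBetween m l' r' := by
  intro v
  simp only [mem_itemsBetween]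
  omega

/-- Half-integral cut positions `x / 2`, `y / 2`, `z / 2` describe a partial allocation. An inner
bundle is valued at the worse of the bundles obtained by rounding both of its cuts down or both
of them up, and an outer bundle without the item at its cut. -/
noncomputable def virtualValue {m : ℕ} (u : Finset (Fin m) → ℝ) (x y z : ℕ) : Fin 4 → ℝ :=
  ![u (itemsBetween m 0 ((x - 1) / 2)),
    min (u (itemsBetween m (x / 2) (y / 2))) (u (itemsBetween m ((x + 1) / 2) ((y + 1) / 2))),
    min (u (itemsBetween m (y / 2) (z / 2))) (u (itemsBetween m ((y + 1) / 2) ((z + 1) / 2))),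
    u (itemsBetween m (z / 2 + 1) m)]

/-- The bundle with the given index has positive length for the cut positions `x`, `y`, `z`. -/
def PosLength (M x y z : ℕ) : Fin 4 → Prop :=
  ![0 < x, x < y, y < z, z < M]

variable {m : ℕ} {u : Finset (Fin m) → ℝ}

lemma virtualValue_nonneg (hu : Monotonic u) (h0 : u ∅ = 0) (x y z : ℕ) (k : Fin 4) :
    0 ≤ virtualValue u x y z k := by
  have h : ∀ X, 0 ≤ u X := fun X => h0 ▸ hu ∅ X (empty_subset X)
  fin_cases k <;> simp [virtualValue, h]

lemma virtualValue_le_zero (h0 : u ∅ = 0) {x y z : ℕ} {k : Fin 4}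
    (hk : ¬ PosLength (2 * m) x y z k) : virtualValue u x y z k ≤ 0 := by
  fin_cases k <;> simp [PosLength] at hk <;> simp only [virtualValue]
  · simp [hk, itemsBetween_eq_empty, h0]
  · exact min_le_of_left_le (by rw [itemsBetween_eq_empty (by omega), h0])
  · exact min_le_of_left_le (by rw [itemsBetween_eq_empty (by omega), h0])
  · simp [itemsBetween_eq_empty (show m ≤ z / 2 + 1 by omega), h0]

lemma exists_favourite_s9 (hu : Monotonic u) (h0 : u ∅ = 0) (hm : 0 < m) (x y z : ℕ) :
    ∃ k, PosLength (2 * m) x y z k ∧ ∀ j, virtualValue u x y z j ≤ virtualValue u x y z k := by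
  classical
  have hne : (univ.filter (PosLength (2 * m) x y z)).Nonempty := by
    by_contra h
    rw [not_nonempty_iff_eq_empty, filter_eq_empty_iff] at h
    have h1 := h (mem_univ 0)
    have h2 := h (mem_univ 1)
    have h3 := h (mem_univ 2)
    have h4 := h (mem_univ 3)
    simp [PosLength] at h1 h2 h3 h4
    omega
  obtain ⟨k, hk, hmax⟩ := exists_max_image _ (virtualValue u x y z) hne
  refine ⟨k, (mem_filter.1 hk).2, fun j => ?_⟩
  by_cases hj : PosLength (2 * m) x y z j
  · exact hmax j (mem_filter.2 ⟨mem_univ j, hj⟩)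
  · exact (virtualValue_le_zero h0 hj).trans (virtualValue_nonneg hu h0 x y z k)

/-- The cut positions obtained by rounding the half-integral positions of the unit cube with
lowest corner `(a, b, c)`; bundle `k` lies between cuts `k` and `k + 1`. -/
def roundedCut (m a b c : ℕ) : Fin 5 → ℕ :=
  ![0, if b % 2 = 1 then (a + 1) / 2 else a / 2, (b + 1) / 2,
    if b % 2 = 1 then c / 2 + 1 else (c + 1) / 2, m]

/-- The bundle with index `k` of the rounded allocation. -/
def roundedBundle (m a b c : ℕ) (k : Fin 4) : Finset (Fin m) :=
  itemsBetween m (roundedCut m a b c k.castSucc) (roundedCut m a b c k.succ)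

lemma virtualValue_le_roundedBundle (hu : Monotonic u) {a b c x y z : ℕ}
    (hx : a ≤ x ∧ x ≤ a + 1) (hy : b ≤ y ∧ y ≤ b + 1) (hz : c ≤ z ∧ z ≤ c + 1) (k : Fin 4) :
    virtualValue u x y z k ≤ u (roundedBundle m a b c k) := by
  have hsub : ∀ {l r l' r' : ℕ}, l' ≤ l → r ≤ r' →
      u (itemsBetween m l r) ≤ u (itemsBetween m l' r') :=
    fun hl hr => hu _ _ (itemsBetween_subset hl hr)
  fin_cases k
  · refine hsub (Nat.zero_le _) ?_
    simp [roundedCut]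
    split_ifs <;> omega
  · rcases Nat.mod_two_eq_zero_or_one b with hb | hb
    · refine min_le_of_left_le (hsub ?_ ?_) <;> simp [roundedCut, hb] <;> omega
    · refine min_le_of_right_le (hsub ?_ ?_) <;> simp [roundedCut, hb] <;> omega
  · rcases Nat.mod_two_eq_zero_or_one b with hb | hb
    · refine min_le_of_left_le (hsub ?_ ?_) <;> simp [roundedCut, hb] <;> omega
    · refine min_le_of_right_le (hsub ?_ ?_) <;> simp [roundedCut, hb] <;> omega
  · refine hsub ?_ le_rfl
    simp [roundedCut]
    split_ifs <;> omega

lemma exists_outer_item {l r : ℕ} (hlr : l < r) (hr : r ≤ m) {w : ℝ}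
    (h : u (itemsBetween m (l + 1) r) ≤ w ∨ u (itemsBetween m l (r - 1)) ≤ w) :
    ∃ v ∈ itemsBetween m l r, IsInterval (itemsBetween m l r \ {v}) ∧
      u (itemsBetween m l r \ {v}) ≤ w := by
  rcases h with h | h
  · have e : itemsBetween m l r \ {⟨l, by omega⟩} = itemsBetween m (l + 1) r := by
      ext v
      simp only [mem_sdiff, mem_singleton, mem_itemsBetween, Fin.ext_iff]
      omega
    refine ⟨⟨l, by omega⟩, by simp [mem_itemsBetween, hlr], ?_⟩
    rw [e]
    exact ⟨isInterval_itemsBetween _ _ _, h⟩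
  · have e : itemsBetween m l r \ {⟨r - 1, by omega⟩} = itemsBetween m l (r - 1) := by
      ext v
      simp only [mem_sdiff, mem_singleton, mem_itemsBetween, Fin.ext_iff]
      omega
    refine ⟨⟨r - 1, by omega⟩, by simp only [mem_itemsBetween]; omega, ?_⟩
    rw [e]
    exact ⟨isInterval_itemsBetween _ _ _, h⟩

lemma roundedCut_monotone {a b c : ℕ} (hab : a ≤ b) (hbc : b ≤ c) (hc : c < 2 * m) :
    Monotone (roundedCut m a b c) := by
  rw [Fin.monotone_iff_le_succ]
  intro k
  fin_cases k <;> simp [roundedCut] <;> split_ifs <;> omega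

lemma roundedBundle_up_to_outer (hu : Monotonic u) {a b c x y z : ℕ}
    (hab : a ≤ b) (hbc : b ≤ c) (hc : c < 2 * m)
    (hx : a ≤ x ∧ x ≤ a + 1) (hy : b ≤ y ∧ y ≤ b + 1) (hz : c ≤ z ∧ z ≤ c + 1) (k : Fin 4) :
    roundedBundle m a b c k = ∅ ∨ ∃ v ∈ roundedBundle m a b c k,
      IsInterval (roundedBundle m a b c k \ {v}) ∧
        u (roundedBundle m a b c k \ {v}) ≤ virtualValue u x y z k := by
  have hsub : ∀ {l r l' r' : ℕ}, l' ≤ l → r ≤ r' →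
      u (itemsBetween m l r) ≤ u (itemsBetween m l' r') :=
    fun hl hr => hu _ _ (itemsBetween_subset hl hr)
  have hor : ∀ {l r l' r' : ℕ}, (l' ≤ l + 1 ∧ r ≤ r') ∨ (l' ≤ l ∧ r - 1 ≤ r') →
      u (itemsBetween m (l + 1) r) ≤ u (itemsBetween m l' r') ∨
        u (itemsBetween m l (r - 1)) ≤ u (itemsBetween m l' r') :=
    fun h => h.imp (fun h => hsub h.1 h.2) (fun h => hsub h.1 h.2)
  rcases le_or_gt (roundedCut m a b c k.succ) (roundedCut m a b c k.castSucc) with hle | hlt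
  · exact Or.inl (itemsBetween_eq_empty hle)
  refine Or.inr (exists_outer_item hlt
    (roundedCut_monotone hab hbc hc (Fin.le_last k.succ)) ?_)
  clear hlt
  fin_cases k
  · refine Or.inr (hsub le_rfl ?_)
    simp [roundedCut]
    split_ifs <;> omega
  · simp only [virtualValue]
    rcases min_choice (u (itemsBetween m (x / 2) (y / 2)))
      (u (itemsBetween m ((x + 1) / 2) ((y + 1) / 2))) with h | h <;>
    · simp only [Fin.mk_one, Matrix.cons_val_one, Matrix.cons_val_zero, h]
      apply hor
      simp [roundedCut]
      split_ifs <;> omega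
  · simp only [virtualValue]
    rcases min_choice (u (itemsBetween m (y / 2) (z / 2)))
      (u (itemsBetween m ((y + 1) / 2) ((z + 1) / 2))) with h | h <;>
    · simp only [Fin.reduceFinMk, Matrix.cons_val, h]
      apply hor
      simp [roundedCut]
      split_ifs <;> omega
  · refine Or.inl (hsub ?_ le_rfl)
    simp [roundedCut]
    split_ifs <;> omega

lemma disjoint_roundedBundle {a b c : ℕ} (h : Monotone (roundedCut m a b c)) {i j : Fin 4}
    (hij : i ≠ j) : Disjoint (roundedBundle m a b c i) (roundedBundle m a b c j) := by
  wlog hlt : i < j generalizing i j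
  · exact (this hij.symm (lt_of_le_of_ne (not_lt.1 hlt) hij.symm)).symm
  rw [disjoint_left]
  intro v hi hj
  have hcut := h (show i.succ ≤ j.castSucc from Fin.succ_le_castSucc_iff.2 hlt)
  simp only [roundedBundle, mem_itemsBetween] at hi hj
  omega

lemma exists_mem_roundedBundle (a b c : ℕ) (v : Fin m) :
    ∃ k, v ∈ roundedBundle m a b c k := by
  by_contra! h
  have h0 := h 0
  have h1 := h 1
  have h2 := h 2
  have h3 := h 3
  simp only [roundedBundle, mem_itemsBetween] at h0 h1 h2 h3
  simp [roundedCut] at h0 h1 h2 h3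
  omega

end Bundles

/-- on a path of `m` items, for four agents with monotonic valuations,
a connected EF1 allocation exists. -/
theorem EF1_exists_four_agents {m : ℕ}
    (u : Fin 4 → Finset (Fin m) → ℝ)
    (hmono : ∀ i, Monotonic (u i)) (h0 : ∀ i, u i ∅ = 0) :
    ∃ A : Fin 4 → Finset (Fin m), IsConnAlloc A ∧ EF1 u A := by
  rcases Nat.eq_zero_or_pos m with rfl | hm
  · exact ⟨fun _ => ∅, ⟨fun _ _ _ _ _ _ h => absurd h (notMem_empty _),
      fun _ _ _ => disjoint_empty_left _, fun v => v.elim0⟩, fun _ _ => Or.inl rfl⟩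
  have hfav := fun x y z : ℕ => exists_favourite_s9 (hmono (Fin.ofNat 4 (x + y + z)))
    (h0 (Fin.ofNat 4 (x + y + z))) hm x y z
  choose f hpos hmax using hfav
  have hpos' : ∀ {x y z : ℕ} {k : Fin 4}, f x y z = k → PosLength (2 * m) x y z k :=
    fun h => h ▸ hpos _ _ _
  have hf : IsAdmissible (2 * m) f :=
    { x_zero := fun y _ z _ h => lt_irrefl 0 (hpos' h)
      x_top := fun y hy z _ h => absurd (hpos' h : 2 * m < y) (not_lt.2 hy)
      y_zero := fun x _ z _ h => Nat.not_lt_zero x (hpos' h)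
      y_top := fun x _ z hz h => absurd (hpos' h : 2 * m < z) (not_lt.2 hz)
      z_zero := fun x _ y _ h => Nat.not_lt_zero y (hpos' h)
      z_top := fun x _ y _ h => lt_irrefl (2 * m) (hpos' h) }
  obtain ⟨a, ha, b, hb, c, hc, p, q, r, hcell, hinj⟩ := hf.exists_rainbow
  have hsurj : ∀ k : Fin 4, ∃ s, f (p s) (q s) (r s) = k := Finite.surjective_of_injective hinj
  have hab : a ≤ b := by
    obtain ⟨s, hs⟩ := hsurj 1
    have h : p s < q s := hpos' hs
    have := hcell s
    omega
  have hbc : b ≤ c := by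
    obtain ⟨s, hs⟩ := hsurj 2
    have h : q s < r s := hpos' hs
    have := hcell s
    omega
  have hagent : Function.Injective fun s => Fin.ofNat 4 (p s + q s + r s) := by
    intro s t hst
    simp only [Fin.ofNat, Fin.mk.injEq] at hst
    have := (hcell s).2.2.2
    have := (hcell t).2.2.2
    omega
  have hagent_surj : ∀ i : Fin 4, ∃ s, Fin.ofNat 4 (p s + q s + r s) = i :=
    Finite.surjective_of_injective hagent
  choose t ht using hagent_surj
  have ht_inj : Function.Injective t := fun i j h => by rw [← ht i, ← ht j, h]
  have ht_surj : Function.Surjective t := Finite.surjective_of_injective ht_inj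
  have hcut := roundedCut_monotone hab hbc hc
  refine ⟨fun i => roundedBundle m a b c (f (p (t i)) (q (t i)) (r (t i))),
    ⟨fun i => isInterval_itemsBetween _ _ _,
      fun i j hij => disjoint_roundedBundle hcut fun h => hij (ht_inj (hinj h)), fun v => ?_⟩,
    fun i j => ?_⟩
  · obtain ⟨k, hk⟩ := exists_mem_roundedBundle a b c v
    obtain ⟨s, rfl⟩ := hsurj k
    obtain ⟨i, rfl⟩ := ht_surj s
    exact ⟨i, hk⟩
  · obtain ⟨hx, hy, hz, -⟩ := hcell (t i)
    refine (roundedBundle_up_to_outer (hmono i) hab hbc hc hx hy hz _).imp_right ?_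
    rintro ⟨v, hv, hint, hle⟩
    refine ⟨v, hv, hint, hle.trans (le_trans ?_
      (virtualValue_le_roundedBundle (hmono i) hx hy hz _))⟩
    have := hmax (p (t i)) (q (t i)) (r (t i)) (f (p (t j)) (q (t j)) (r (t j)))
    rwa [ht i] at this
end
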